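/- arXiv:0710.1816 — 2 statements merged into one kernel-verified Lean document; each statement's English description precedes it below -/
import Mathlib

section
/- Let k ≥ 1 and n ≥ 2k−1, and let N be the number of equivalence classes of the relation ∼_cr on Π_{n,k}. Then 16·N = (n−k−1)(k−1)·2^{k+2} + 2^{k+3} − (k−1)(k−2)·2^{k} (equivalently, N = (n−k−1)(k−1)2^{k−2} + 2^{k−1} − (k−1)(k−2)2^{k−4} as rational numbers). -/
open Finset

/-- A set partition of `[n] = {1,…,n}`, modeled as a `Finpartition` of `Fin n`. -/
abbrev SetPartition (n : ℕ) := Finpartition (Finset.univ : Finset (Fin n))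

/-- `(i,j)` is an arc of the partition `p`: `i < j`, they lie in a common block,
and no element of that block lies strictly between them. -/
def IsArc {n : ℕ} (p : SetPartition n) (i j : Fin n) : Prop :=
  i < j ∧ ∃ B ∈ p.parts, i ∈ B ∧ j ∈ B ∧ ∀ x ∈ B, ¬ (i < x ∧ x < j)

/-- Arcs `a = (i₁,j₁)` and `b = (i₂,j₂)` form a crossing: `i₁ < i₂ < j₁ < j₂`. -/
def Crossing {n : ℕ} (a b : Fin n × Fin n) : Prop :=
  a.1 < b.1 ∧ b.1 < a.2 ∧ a.2 < b.2

/-- Arcs `a = (i₁,j₁)` and `b = (i₂,j₂)` form a nesting: `i₁ < i₂ < j₂ < j₁`. -/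
def Nesting {n : ℕ} (a b : Fin n × Fin n) : Prop :=
  a.1 < b.1 ∧ b.1 < b.2 ∧ b.2 < a.2

/-- `cr p`: the number of crossings of two arcs in `p`. -/
noncomputable def cr {n : ℕ} (p : SetPartition n) : ℕ :=
  {e : (Fin n × Fin n) × (Fin n × Fin n) |
    IsArc p e.1.1 e.1.2 ∧ IsArc p e.2.1 e.2.2 ∧ Crossing e.1 e.2}.ncard

/-- `ne' p`: the number of nestings of two arcs in `p`. -/
noncomputable def ne' {n : ℕ} (p : SetPartition n) : ℕ :=
  {e : (Fin n × Fin n) × (Fin n × Fin n) |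
    IsArc p e.1.1 e.1.2 ∧ IsArc p e.2.1 e.2.2 ∧ Nesting e.1 e.2}.ncard

/-- `al p`: the number of alignments (unordered pairs of arcs that neither
cross nor nest, counted with first endpoints in increasing order). -/
noncomputable def al {n : ℕ} (p : SetPartition n) : ℕ :=
  {e : (Fin n × Fin n) × (Fin n × Fin n) |
    IsArc p e.1.1 e.1.2 ∧ IsArc p e.2.1 e.2.2 ∧ e.1.1 < e.2.1 ∧
    ¬ Crossing e.1 e.2 ∧ ¬ Crossing e.2 e.1 ∧
    ¬ Nesting e.1 e.2 ∧ ¬ Nesting e.2 e.1}.ncard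

/-- `i` and `j` lie in a common block of `p`. -/
def InSameBlock {n : ℕ} (p : SetPartition n) (i j : Fin n) : Prop :=
  ∃ B ∈ p.parts, i ∈ B ∧ j ∈ B

/-- `c` (a partition of `[n+1]`) is a child of `p` (a partition of `[n]`):
deleting the element `1` from `c` and shifting down by one yields `p`. -/
def IsChild {n : ℕ} (c : SetPartition (n + 1)) (p : SetPartition n) : Prop :=
  ∀ i j : Fin n, (InSameBlock p i j ↔ InSameBlock c i.succ j.succ)

/-- `level p l` is `T(p, l)`: the set of partitions of `[n+l]` at the `l`-th level of
the subtree rooted at `p` in the tree of partitions. -/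
def level {n : ℕ} (p : SetPartition n) : (l : ℕ) → Set (SetPartition (n + l))
  | 0 => {p}
  | l + 1 => {c | ∃ q ∈ level p l, IsChild c q}

/-- The statistic `s_{α,β}(p) = cr(p)·α + ne(p)·β`. -/
noncomputable def statS {G : Type*} [AddCommGroup G] (α β : G) {n : ℕ} (p : SetPartition n) : G :=
  cr p • α + ne' p • β

/-- The minimum of a block, as a natural number (`0` for the empty set). -/
noncomputable def minOfBlock {n : ℕ} (B : Finset (Fin n)) : ℕ :=
  sInf (Fin.val '' (B : Set (Fin n)))

/-- `u(p, b)`: the number of arcs `(x, y)` of `p` with `x < b < y` (values in `ℕ`). -/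
noncomputable def uStat {n : ℕ} (p : SetPartition n) (b : ℕ) : ℕ :=
  {e : Fin n × Fin n | IsArc p e.1 e.2 ∧ (e.1 : ℕ) < b ∧ b < (e.2 : ℕ)}.ncard

/-- `v(p, b)`: the number of arcs `(x, y)` of `p` with `x < y < b` (values in `ℕ`). -/
noncomputable def vStat {n : ℕ} (p : SetPartition n) (b : ℕ) : ℕ :=
  {e : Fin n × Fin n | IsArc p e.1 e.2 ∧ (e.2 : ℕ) < b}.ncard

/-- `crset p`: the multiset `{u₁(p), …, u_k(p)}`, where `u_i(p)` is the number of arcs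
passing over the minimum `b_i` of the `i`-th block. -/
noncomputable def crset {n : ℕ} (p : SetPartition n) : Multiset ℕ :=
  p.parts.val.map fun B => uStat p (minOfBlock B)

/-- `neseq p`: the sequence `(v₁(p), …, v_k(p))`, where `v_i(p)` is the number of arcs
lying entirely to the left of the minimum `b_i` of the `i`-th block, blocks being ordered
by increasing minima. -/
noncomputable def neseq {n : ℕ} (p : SetPartition n) : List ℕ :=
  ((p.parts.image fun B => minOfBlock B).sort (· ≤ ·)).map fun b => vStat p b

/-- `p ∼_cr q`: the statistic `cr` has the same distribution on `T(p,l,m)` and `T(q,l,m)`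
for all `l, m ≥ 0` (multiset equality expressed by counting, for each value `c`, the
partitions attaining it). -/
def SimCr {n : ℕ} (p q : SetPartition n) : Prop :=
  ∀ l m c : ℕ,
    {t ∈ level p l | t.parts.card = m ∧ cr t = c}.ncard =
    {t ∈ level q l | t.parts.card = m ∧ cr t = c}.ncard

/-- `p ∼_ne q`: the statistic `ne` has the same distribution on `T(p,l,m)` and `T(q,l,m)`
for all `l, m ≥ 0`. -/
def SimNe {n : ℕ} (p q : SetPartition n) : Prop :=
  ∀ l m c : ℕ,
    {t ∈ level p l | t.parts.card = m ∧ ne' t = c}.ncard =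
    {t ∈ level q l | t.parts.card = m ∧ ne' t = c}.ncard

/-- `∼_cr` as a setoid on `Π_{n,k}`, the partitions of `[n]` with exactly `k` blocks. -/
def crSetoid (n k : ℕ) : Setoid {p : SetPartition n // p.parts.card = k} :=
  ⟨fun p q => SimCr p.1 q.1,
    ⟨fun _ _ _ _ => rfl, fun h l m c => (h l m c).symm,
      fun h₁ h₂ l m c => (h₁ l m c).trans (h₂ l m c)⟩⟩

/-- `∼_ne` as a setoid on `Π_{n,k}`, the partitions of `[n]` with exactly `k` blocks. -/
def neSetoid (n k : ℕ) : Setoid {p : SetPartition n // p.parts.card = k} :=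
  ⟨fun p q => SimNe p.1 q.1,
    ⟨fun _ _ _ _ => rfl, fun h l m c => (h l m c).symm,
      fun h₁ h₂ l m c => (h₁ l m c).trans (h₂ l m c)⟩⟩

/-- `∼_ne` as a setoid on all of `Π_n`. -/
def neSetoidAll (n : ℕ) : Setoid (SetPartition n) :=
  ⟨SimNe,
    ⟨fun _ _ _ _ => rfl, fun h l m c => (h l m c).symm,
      fun h₁ h₂ l m c => (h₁ l m c).trans (h₂ l m c)⟩⟩


/-! ### Generating trees of crossing states

A partition is summarised by its *state* `(c, u)`, where `c` is its number of crossings and `u`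
lists the numbers of arcs passing over the block minima, from left to right. -/

/-- The ways to remove an entry from a list and increment all the entries preceding it,
each paired with the removed entry. -/
def removals : List ℕ → List (ℕ × List ℕ)
  | [] => []
  | a :: u => (a, u) :: (removals u).map fun r => (r.1, (a + 1) :: r.2)

/-- The states of the children of a partition with state `s`. -/
def childStates (s : ℕ × List ℕ) : List (ℕ × List ℕ) :=
  (s.1, 0 :: s.2) :: (removals s.2).map fun r => (s.1 + r.1, 0 :: r.2)

/-- The states of the `l`-th level descendants of a partition with state `s`. -/
def descendantStates (s : ℕ × List ℕ) : ℕ → List (ℕ × List ℕ)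
  | 0 => [s]
  | l + 1 => (descendantStates s l).flatMap childStates

theorem mem_removals {u : List ℕ} {r : ℕ × List ℕ} :
    r ∈ removals u ↔ ∃ u₁ u₂, u = u₁ ++ r.1 :: u₂ ∧ r.2 = u₁.map Nat.succ ++ u₂ := by
  induction u generalizing r with
  | nil => simp [removals]
  | cons a u ih =>
    simp only [removals, List.mem_cons, List.mem_map, ih]
    constructor
    · rintro (rfl | ⟨r, ⟨u₁, u₂, rfl, h⟩, rfl⟩)
      · exact ⟨[], u, rfl, rfl⟩
      · exact ⟨a :: u₁, u₂, rfl, by simp [h]⟩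
    · rintro ⟨_ | ⟨b, u₁⟩, u₂, h, h'⟩
      · left
        simp at h h'
        ext1 <;> simp [h, h']
      · right
        simp only [List.cons_append, List.cons.injEq] at h
        refine ⟨(r.1, u₁.map Nat.succ ++ u₂), ⟨u₁, u₂, h.2, rfl⟩, ?_⟩
        ext1 <;> simp [h, h']

theorem map_fst_removals (u : List ℕ) : (removals u).map Prod.fst = u := by
  induction u with
  | nil => rfl
  | cons a u ih =>
    simp only [removals, List.map_cons, List.map_map]
    exact congrArg (a :: ·) ih

theorem length_of_mem_removals {u : List ℕ} {r : ℕ × List ℕ} (h : r ∈ removals u) :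
    r.2.length + 1 = u.length := by
  obtain ⟨u₁, u₂, rfl, hr⟩ := mem_removals.1 h
  simp only [hr, List.length_append, List.length_map, List.length_cons]
  omega

section GeneratingFunction

open Polynomial

/-- The indeterminate marking crossings. -/
noncomputable def crossingVar : ℤ[X][X] := C X

/-- The generating polynomial of the `q`-analogues of the elementary symmetric functions of
the entries of a list. -/
noncomputable def listPoly (u : List ℕ) : ℤ[X][X][X] :=
  (u.map fun a => C X * (1 + C (crossingVar ^ a) * X)).prod

/-- The generating polynomial of a list of states. -/
noncomputable def statesPoly (L : List (ℕ × List ℕ)) : ℤ[X][X][X] :=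
  (L.map fun s => C (crossingVar ^ s.1) * listPoly s.2).sum

/-- The substitution dilating the outer indeterminate by `crossingVar`. -/
noncomputable def dilate : ℤ[X][X][X] →+* ℤ[X][X][X] := compRingHom (C crossingVar * X)

theorem listPoly_cons (a : ℕ) (u : List ℕ) :
    listPoly (a :: u) = C X * (1 + C (crossingVar ^ a) * X) * listPoly u := by
  simp [listPoly]

theorem listPoly_eq_of_perm {u v : List ℕ} (h : u.Perm v) : listPoly u = listPoly v := by
  induction h with
  | nil => rfl
  | cons a _ ih => rw [listPoly_cons, listPoly_cons, ih]
  | swap a b w => simp only [listPoly_cons]; ring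
  | trans _ _ ih₁ ih₂ => exact ih₁.trans ih₂

theorem statesPoly_append (L M : List (ℕ × List ℕ)) :
    statesPoly (L ++ M) = statesPoly L + statesPoly M := by
  simp [statesPoly]

theorem sum_removals (u : List ℕ) :
    ((removals u).map fun r => C (crossingVar ^ r.1) * listPoly r.2).sum *
        (C X * (C (crossingVar - 1) * X)) = dilate (listPoly u) - listPoly u := by
  induction u with
  | nil =>
    simp only [removals, listPoly, List.map_nil, List.sum_nil, List.prod_nil, map_one, zero_mul]
    ring
  | cons a u ih =>
    have h₁ : ((removals u).map fun r => C (crossingVar ^ r.1) * listPoly ((a + 1) :: r.2)).sum =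
        C X * (1 + C (crossingVar ^ (a + 1)) * X) *
          ((removals u).map fun r => C (crossingVar ^ r.1) * listPoly r.2).sum := by
      rw [← List.sum_map_mul_left]
      congr 2
      ext1 r
      rw [listPoly_cons]
      ring
    have h₂ : dilate (C X * (1 + C (crossingVar ^ a) * X)) =
        C X * (1 + C (crossingVar ^ (a + 1)) * X) := by
      simp [dilate, pow_succ]
      ring
    simp only [removals, List.map_cons, List.sum_cons, List.map_map, Function.comp_def]
    rw [h₁, listPoly_cons, map_mul, h₂]
    have h₃ : dilate (listPoly u) = ((removals u).map fun r =>
        C (crossingVar ^ r.1) * listPoly r.2).sum *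
        (C X * (C (crossingVar - 1) * X)) + listPoly u := by rw [ih]; ring
    rw [h₃]
    simp only [map_sub, map_one, pow_succ, map_mul]
    ring

theorem statesPoly_childStates (s : ℕ × List ℕ) :
    statesPoly (childStates s) * (C (crossingVar - 1) * X) =
      (1 + X) * (C X * (C (crossingVar - 1) * X) * statesPoly [s] + dilate (statesPoly [s]) -
        statesPoly [s]) := by
  have h : ((removals s.2).map fun r => C (crossingVar ^ (s.1 + r.1)) * listPoly (0 :: r.2)).sum =
      C (crossingVar ^ s.1) * (C X * (1 + X)) *
        ((removals s.2).map fun r => C (crossingVar ^ r.1) * listPoly r.2).sum := by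
    rw [← List.sum_map_mul_left]
    congr 2
    ext1 r
    rw [listPoly_cons, pow_add, map_mul, pow_zero, map_one]
    ring
  have hd : dilate (C (crossingVar ^ s.1)) = C (crossingVar ^ s.1) := by simp [dilate]
  simp only [statesPoly, childStates, List.map_cons, List.sum_cons, List.map_map,
    Function.comp_def, List.map_nil, List.sum_nil, add_zero]
  rw [h, map_mul, hd, ← sub_add_cancel (dilate (listPoly s.2)) (listPoly s.2), ← sum_removals,
    listPoly_cons]
  simp only [pow_zero, map_one]
  ring

theorem statesPoly_flatMap_childStates (L : List (ℕ × List ℕ)) :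
    statesPoly (L.flatMap childStates) * (C (crossingVar - 1) * X) =
      (1 + X) * (C X * (C (crossingVar - 1) * X) * statesPoly L + dilate (statesPoly L) -
        statesPoly L) := by
  induction L with
  | nil =>
    simp only [statesPoly, List.flatMap_nil, List.map_nil, List.sum_nil, map_zero]
    ring
  | cons s L ih =>
    rw [List.flatMap_cons, statesPoly_append, add_mul, ih, statesPoly_childStates,
      ← List.singleton_append (l := L), statesPoly_append, map_add]
    ring

theorem statesPoly_descendantStates_congr {s t : ℕ × List ℕ}
    (h : statesPoly [s] = statesPoly [t]) (l : ℕ) :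
    statesPoly (descendantStates s l) = statesPoly (descendantStates t l) := by
  induction l with
  | zero => exact h
  | succ l ih =>
    have hne : (C (crossingVar - 1) * X : ℤ[X][X][X]) ≠ 0 := by
      refine mul_ne_zero ?_ X_ne_zero
      rw [Ne, C_eq_zero, crossingVar, sub_eq_zero, ← C_1, C_inj]
      exact fun h => by simpa using congrArg (coeff · 0) h
    apply mul_right_cancel₀ hne
    simp only [descendantStates]
    rw [statesPoly_flatMap_childStates, statesPoly_flatMap_childStates, ih]

theorem countP_eq_coeff_statesPoly (L : List (ℕ × List ℕ)) (m c : ℕ) :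
    (L.countP fun s => s.2.length = m ∧ s.1 = c : ℤ) =
      (((statesPoly L).coeff 0).coeff m).coeff c := by
  induction L with
  | nil => simp [statesPoly]
  | cons s L ih =>
    have h₀ : (listPoly s.2).coeff 0 = X ^ s.2.length := by
      induction s.2 with
      | nil => simp [listPoly]
      | cons a u ih => simp [listPoly_cons, mul_coeff_zero, ih, pow_succ, mul_comm]
    have h₁ : (((statesPoly [s]).coeff 0).coeff m).coeff c =
        if s.2.length = m ∧ s.1 = c then 1 else 0 := by
      simp only [statesPoly, List.map_cons, List.map_nil, List.sum_cons, List.sum_nil, add_zero,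
        coeff_C_mul, h₀, crossingVar, ← C_pow, coeff_X_pow]
      by_cases hm : m = s.2.length <;> by_cases hc : c = s.1 <;>
        simp [hm, hc, coeff_X_pow, eq_comm]
    rw [← List.singleton_append (l := L), statesPoly_append, List.countP_append, coeff_add,
      coeff_add,
      coeff_add, ← ih, h₁, Nat.cast_add]
    simp [List.countP_cons]

end GeneratingFunction

theorem countP_descendantStates_of_perm {c : ℕ} {u v : List ℕ} (h : u.Perm v) (l m d : ℕ) :
    (descendantStates (c, u) l).countP (fun s => s.2.length = m ∧ s.1 = d) =
      (descendantStates (c, v) l).countP (fun s => s.2.length = m ∧ s.1 = d) := by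
  have hp : statesPoly [(c, u)] = statesPoly [(c, v)] := by
    simp only [statesPoly, List.map_cons, List.map_nil, listPoly_eq_of_perm h]
  apply Nat.cast_injective (R := ℤ)
  rw [countP_eq_coeff_statesPoly, countP_eq_coeff_statesPoly,
    statesPoly_descendantStates_congr hp]

theorem perm_of_countP_descendantStates {c d : ℕ} {u v : List ℕ} (hlen : u.length = v.length)
    (h : ∀ l m e, (descendantStates (c, u) l).countP (fun s => s.2.length = m ∧ s.1 = e) =
      (descendantStates (d, v) l).countP (fun s => s.2.length = m ∧ s.1 = e)) :
    c = d ∧ u.Perm v := by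
  have hcd : c = d := by
    have := h 0 u.length c
    simp [descendantStates, hlen] at this
    exact this.symm
  subst hcd
  refine ⟨rfl, List.perm_iff_count.2 fun a => ?_⟩
  have key : ∀ w : List ℕ, (descendantStates (c, w) 1).countP
      (fun s => s.2.length = w.length ∧ s.1 = c + a) = w.count a := by
    intro w
    conv_rhs => rw [← map_fst_removals w, List.count, List.countP_map]
    simp only [descendantStates, List.flatMap_cons, List.flatMap_nil, List.append_nil, childStates,
      List.countP_cons, List.countP_map]
    simp only [List.length_cons, Nat.succ_ne_self, false_and, decide_false, Bool.false_eq_true,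
      if_false, add_zero]
    refine List.countP_congr fun r hr => ?_
    simp [length_of_mem_removals hr]
  rw [← key u, h 1, hlen, key v]

/-! ### Reachable states -/

/-- `Reachable A c u` holds if some partition with `A` arcs has state `(c, u)`. -/
inductive Reachable : ℕ → ℕ → List ℕ → Prop
  | nil : Reachable 0 0 []
  | single {A c u} : Reachable A c u → Reachable A c (0 :: u)
  | join {A c u₁ a u₂} : Reachable A c (u₁ ++ a :: u₂) →
      Reachable (A + 1) (c + a) (0 :: (u₁.map Nat.succ ++ u₂))

theorem Reachable.of_mem_childStates {A : ℕ} {s t : ℕ × List ℕ} (h : Reachable A s.1 s.2)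
    (ht : t ∈ childStates s) :
    ∃ B, Reachable B t.1 t.2 ∧ B + t.2.length = A + s.2.length + 1 := by
  obtain ⟨c, u⟩ := s
  simp only [childStates, List.mem_cons, List.mem_map] at ht
  obtain rfl | ⟨r, hr, rfl⟩ := ht
  · exact ⟨A, h.single, by simp [add_assoc]⟩
  · obtain ⟨u₁, u₂, hu, hr₂⟩ := mem_removals.1 hr
    subst hu
    refine ⟨A + 1, ?_, ?_⟩
    · rw [hr₂]
      exact h.join
    · simp [hr₂]
      omega

/-- The largest number of crossings of a partition with `A` arcs such that at most `m` arcs pass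
over any block minimum. -/
def maxCrossings (A m : ℕ) : ℕ := ∑ j ∈ range A, min m j

/-- The list starts with an entry that is at most `h`, and every further entry exceeds its
predecessor by at most one. -/
def SlowFrom : ℕ → List ℕ → Prop
  | _, [] => True
  | h, a :: u => a ≤ h ∧ SlowFrom (a + 1) u

namespace SlowFrom

theorem mono {g h : ℕ} (hgh : g ≤ h) {u : List ℕ} (hu : SlowFrom g u) : SlowFrom h u := by
  cases u with
  | nil => trivial
  | cons a u => exact ⟨hu.1.trans hgh, hu.2⟩

theorem removal {h a : ℕ} {u₁ u₂ : List ℕ} (hu : SlowFrom h (u₁ ++ a :: u₂)) :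
    SlowFrom (h + 1) (u₁.map Nat.succ ++ u₂) := by
  induction u₁ generalizing h with
  | nil => exact mono (Nat.succ_le_succ hu.1) hu.2
  | cons b u₁ ih => exact ⟨Nat.succ_le_succ hu.1, ih hu.2⟩

theorem mem_of_le {h a b : ℕ} {u : List ℕ} (hu : SlowFrom h u) (ha : a ∈ u) (hb : h ≤ b)
    (hba : b ≤ a) : b ∈ u := by
  induction u generalizing h with
  | nil => simp at ha
  | cons d u ih =>
    obtain ⟨hd, hu⟩ := hu
    rcases eq_or_ne b d with rfl | hbd
    · simp
    · refine List.mem_cons_of_mem _ (ih hu ?_ (by omega))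
      rcases List.mem_cons.1 ha with rfl | ha
      · omega
      · exact ha

theorem le_of_forall_mem_lt {h a m : ℕ} {u₁ u₂ : List ℕ} (hu : SlowFrom h (u₁ ++ a :: u₂))
    (hm : h ≤ m) (h₁ : ∀ x ∈ u₁, x < m) : a ≤ m := by
  induction u₁ generalizing h with
  | nil => exact hu.1.trans hm
  | cons b u₁ ih =>
    exact ih hu.2 (h₁ b (by simp)) fun x hx => h₁ x (by simp [hx])

end SlowFrom

theorem Reachable.invariants {A c : ℕ} {u : List ℕ} (h : Reachable A c u) :
    SlowFrom 0 u ∧ (∀ a ∈ u, a ≤ A) ∧ ∀ m, (∀ a ∈ u, a ≤ m) → c ≤ maxCrossings A m := by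
  induction h with
  | nil => simp [SlowFrom]
  | single _ ih =>
    obtain ⟨h₁, h₂, h₃⟩ := ih
    refine ⟨⟨le_rfl, h₁.mono zero_le_one⟩, by simpa using h₂, fun m hm => h₃ m ?_⟩
    exact fun a ha => hm a (List.mem_cons_of_mem _ ha)
  | @join A c u₁ a u₂ _ ih =>
    obtain ⟨h₁, h₂, h₃⟩ := ih
    refine ⟨⟨le_rfl, h₁.removal⟩, ?_, fun m hm => ?_⟩
    · intro x hx
      simp only [List.mem_cons, List.mem_append, List.mem_map] at hx
      rcases hx with rfl | ⟨y, hy, rfl⟩ | hx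
      · simp
      · exact Nat.succ_le_succ (h₂ y (by simp [hy]))
      · exact (h₂ x (by simp [hx])).trans (Nat.le_succ A)
    · have hlt : ∀ x ∈ u₁, x < m := fun x hx => hm (x + 1) (by simp [hx])
      have ham : a ≤ m := h₁.le_of_forall_mem_lt (Nat.zero_le m) hlt
      have hc : c ≤ maxCrossings A m := by
        refine h₃ m fun x hx => ?_
        simp only [List.mem_append, List.mem_cons] at hx
        rcases hx with hx | rfl | hx
        · exact (hlt x hx).le
        · exact ham
        · exact hm x (by simp [hx])
      rw [maxCrossings, sum_range_succ]
      exact add_le_add hc (le_min ham (h₂ a (by simp)))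

theorem Reachable.exists_max {A c : ℕ} {u : List ℕ} (h : Reachable A c u) (hu : u ≠ []) :
    ∃ m, (∀ i, i ∈ u ↔ i ≤ m) ∧ m ≤ A ∧ c ≤ maxCrossings A m := by
  obtain ⟨h₁, h₂, h₃⟩ := h.invariants
  obtain ⟨m, hm, hmax⟩ := u.toFinset.exists_max_image id (List.toFinset_nonempty_iff u |>.2 hu)
  simp only [List.mem_toFinset, id] at hm hmax
  exact ⟨m, fun i => ⟨hmax i, fun hi => h₁.mem_of_le hm (Nat.zero_le i) hi⟩, h₂ m hm, h₃ m hmax⟩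

/-- The weakly increasing lists whose entries are exactly the numbers `0, …, m`. -/
inductive Staircase : ℕ → List ℕ → Prop
  | replicate (b : ℕ) : Staircase 0 (0 :: List.replicate b 0)
  | step {m D} (b : ℕ) : Staircase m D →
      Staircase (m + 1) (List.replicate b 0 ++ 0 :: D.map Nat.succ)

theorem Staircase.exists_perm {m : ℕ} {u : List ℕ} (h : ∀ i, i ∈ u ↔ i ≤ m) :
    ∃ D, Staircase m D ∧ D.Perm u := by
  induction m generalizing u with
  | zero =>
    have hu : u = List.replicate u.length 0 :=
      List.eq_replicate_of_mem fun i hi => Nat.le_zero.1 ((h i).1 hi)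
    cases u with
    | nil => simpa using (h 0).2
    | cons a u =>
      rw [hu]
      exact ⟨_, .replicate u.length, .refl _⟩
  | succ m ih =>
    set v := (u.filter (· ≠ 0)).map Nat.pred with hv
    have hvu : v.map Nat.succ = u.filter (· ≠ 0) := by
      rw [hv, List.map_map]
      refine (List.map_congr_left fun a ha => ?_).trans (List.map_id _)
      exact Nat.succ_pred (by simpa using (List.mem_filter.1 ha).2)
    obtain ⟨D, hD, hDv⟩ := @ih v fun i => by
      rw [← List.mem_map_of_injective Nat.succ_injective, hvu, List.mem_filter, h]
      simp
    have hz : u.filter (· = 0) = List.replicate (u.filter (· = 0)).length 0 :=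
      List.eq_replicate_of_mem fun i hi => by simpa using (List.mem_filter.1 hi).2
    have hpos : (u.filter (· = 0)).length ≠ 0 := by
      have := List.length_pos_of_mem (List.mem_filter.2 ⟨(h 0).2 (Nat.zero_le _), by simp⟩ :
        0 ∈ u.filter (· = 0))
      omega
    obtain ⟨b, hb⟩ := Nat.exists_eq_succ_of_ne_zero hpos
    refine ⟨_, .step b hD, ?_⟩
    have hsplit : (u.filter (· = 0) ++ u.filter (· ≠ 0)).Perm u := by
      simpa using List.filter_append_perm (· = 0) u
    refine List.Perm.trans ?_ hsplit
    rw [hz, hb, ← hvu, List.replicate_succ', List.append_assoc]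
    exact (List.Perm.cons _ (hDv.map _)).append_left _

theorem Staircase.exists_removal {m : ℕ} {D : List ℕ} (h : Staircase m D) {t : ℕ} (ht : t ≤ m) :
    ∃ b u₁ u₂, Staircase m (u₁ ++ t :: u₂) ∧
      D = List.replicate b 0 ++ 0 :: (u₁.map Nat.succ ++ u₂) := by
  induction h generalizing t with
  | replicate b =>
    obtain rfl := Nat.le_zero.1 ht
    exact ⟨b, [], [], .replicate 0, by
      rw [← List.replicate_succ, List.replicate_succ']; simp⟩
  | @step m D b hD ih =>
    rcases t with _ | t
    · exact ⟨b, [], D.map Nat.succ, .step 0 hD, rfl⟩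
    · obtain ⟨d, u₁, u₂, hst, rfl⟩ := ih (Nat.le_of_succ_le_succ ht)
      refine ⟨b, List.replicate d 0 ++ 0 :: u₁.map Nat.succ, u₂.map Nat.succ, ?_, by simp⟩
      simpa using Staircase.step d hst

theorem Reachable.replicate_append {A c : ℕ} {u : List ℕ} (h : Reachable A c u) (b : ℕ) :
    Reachable A c (List.replicate b 0 ++ u) := by
  induction b with
  | zero => exact h
  | succ b ih => exact ih.single

theorem Reachable.grow {A c a : ℕ} {D r₁ r₂ : List ℕ} (b : ℕ)
    (h : Reachable A c (D ++ (r₁ ++ a :: r₂))) :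
    Reachable (A + 1) (c + a)
      ((List.replicate b 0 ++ 0 :: D.map Nat.succ) ++ (r₁.map Nat.succ ++ r₂)) := by
  rw [← List.append_assoc] at h
  simpa using h.join.replicate_append b

theorem Staircase.exists_forall_reachable {m q : ℕ} {D : List ℕ} (hD : Staircase (m + q) D) :
    ∃ D', Staircase m D' ∧
      (∀ A c r, r.length = q → Reachable A c (D' ++ r) → Reachable (A + q) (c + r.sum) D) ∧
      ∀ A c s e, e ≤ ∑ j ∈ range q, j → Reachable A c (D' ++ List.replicate q s) →
        Reachable (A + q) (c + s * q + e) D := by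
  induction q generalizing m with
  | zero =>
    refine ⟨D, hD, fun A c r hr h => ?_, fun A c s e he h => ?_⟩
    · obtain rfl := List.length_eq_zero_iff.1 hr
      simpa using h
    · obtain rfl : e = 0 := by simpa using he
      simpa using h
  | succ q ih =>
    rw [← Nat.add_assoc, Nat.add_right_comm] at hD
    obtain ⟨_, hD', hfirst, hall⟩ := ih hD
    cases hD' with | @step _ D' b hD' =>
    refine ⟨D', hD', fun A c r hr h => ?_, fun A c s e he h => ?_⟩
    · obtain ⟨a, r, rfl⟩ := List.exists_cons_of_length_eq_add_one hr
      have := hfirst _ _ r (by simpa using hr) (Reachable.grow (r₁ := []) b h)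
      rwa [List.sum_cons, ← Nat.add_assoc, ← Nat.add_assoc, Nat.add_right_comm A]
    · rcases le_or_gt e q with heq | heq
      · have hsplit : List.replicate (q + 1) s =
            List.replicate e s ++ s :: List.replicate (q - e) s := by
          rw [← List.replicate_succ, List.replicate_append_replicate]
          congr 1
          omega
        rw [hsplit] at h
        have := hfirst _ _ _ (by simp; omega) (h.grow b)
        convert this using 1
        · omega
        · obtain ⟨d, rfl⟩ := Nat.exists_eq_add_of_le heq
          simp
          ring
      · rw [List.replicate_succ'] at h
        have := h.grow b
        rw [List.append_nil, List.map_replicate] at this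
        rw [sum_range_succ] at he
        convert hall _ _ _ (e - q) (by omega) this using 1
        · omega
        · obtain ⟨d, rfl⟩ := Nat.exists_eq_add_of_le heq.le
          simp only [Nat.add_sub_cancel_left, Nat.succ_eq_add_one]
          ring

theorem Staircase.reachable {A m c : ℕ} {D : List ℕ} (hD : Staircase m D) (hmA : m ≤ A)
    (hc : c ≤ maxCrossings A m) : Reachable A c D := by
  induction A, hmA using Nat.le_induction generalizing c D with
  | base =>
    obtain ⟨D', hD', -, h⟩ := exists_forall_reachable (m := 0) (q := m) (by simpa using hD)
    cases hD' with | replicate b =>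
    have hc' : c ≤ ∑ j ∈ range m, j := by
      refine hc.trans (sum_le_sum fun j _ => min_le_right m j)
    have h₀ : Reachable 0 0 ((0 :: List.replicate b 0) ++ List.replicate m 0) := by
      rw [← List.replicate_succ, List.replicate_append_replicate]
      simpa using Reachable.nil.replicate_append (b + 1 + m)
    simpa using h 0 0 0 c hc' h₀
  | succ A hmA ih =>
    obtain ⟨b, u₁, u₂, hst, rfl⟩ := hD.exists_removal (min_le_right c m)
    rw [maxCrossings, sum_range_succ, min_eq_left hmA] at hc
    have := (ih (c := c - min c m) hst (by rw [maxCrossings]; omega)).join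
    rw [Nat.sub_add_cancel (min_le_left c m)] at this
    exact this.replicate_append b

theorem exists_reachable_iff {A c : ℕ} {M : Multiset ℕ} (hM : M ≠ 0) (hA : M.card ≤ A + 1) :
    (∃ u : List ℕ, Reachable A c u ∧ (u : Multiset ℕ) = M) ↔
      ∃ m, (∀ i, i ∈ M ↔ i ≤ m) ∧ c ≤ maxCrossings A m := by
  constructor
  · rintro ⟨u, hu, rfl⟩
    obtain ⟨m, h, -, hc⟩ := hu.exists_max (by simpa using hM)
    exact ⟨m, h, hc⟩
  · rintro ⟨m, hm, hc⟩
    induction M using Quotient.inductionOn with | _ u =>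
    obtain ⟨D, hD, hDu⟩ := Staircase.exists_perm hm
    refine ⟨D, hD.reachable ?_ hc, Quotient.sound hDu⟩
    have hsub : (Multiset.range (m + 1)) ≤ (u : Multiset ℕ) :=
      (Multiset.le_iff_subset (Multiset.nodup_range _)).2 fun i hi =>
        (hm i).2 (Nat.lt_succ_iff.1 (Multiset.mem_range.1 hi))
    have := (Multiset.card_le_card hsub).trans hA
    simpa using this

/-! ### Counting reachable states -/

/-- The multisets with `K + 1` elements whose underlying set is `{0, …, m}`. -/
def intervalMultisets (K m : ℕ) : Finset (Multiset ℕ) :=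
  univ.image fun s : Sym (Fin (m + 1)) (K - m) =>
    Multiset.range (m + 1) + (s : Multiset (Fin (m + 1))).map Fin.val

theorem card_intervalMultisets {K m : ℕ} (hm : m ≤ K) :
    (intervalMultisets K m).card = K.choose m := by
  rw [intervalMultisets, card_image_of_injective, card_univ, Sym.card_sym_fin_eq_multichoose,
    Nat.multichoose_eq]
  · rw [show m + 1 + (K - m) - 1 = K by omega, Nat.choose_symm hm]
  · intro s t h
    exact Sym.coe_injective (Multiset.map_injective Fin.val_injective (add_left_cancel h))

theorem mem_intervalMultisets {K m : ℕ} (hm : m ≤ K) {M : Multiset ℕ} :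
    M ∈ intervalMultisets K m ↔ M.card = K + 1 ∧ ∀ i, i ∈ M ↔ i ≤ m := by
  simp only [intervalMultisets, mem_image, mem_univ, true_and]
  constructor
  · rintro ⟨s, rfl⟩
    refine ⟨by simp; omega, fun i => ?_⟩
    simp only [Multiset.mem_add, Multiset.mem_range, Multiset.mem_map, Order.lt_add_one_iff]
    refine ⟨?_, Or.inl⟩
    rintro (h | ⟨j, -, rfl⟩)
    · exact h
    · exact Nat.lt_succ_iff.1 j.2
  · rintro ⟨hcard, hM⟩
    have hsub : Multiset.range (m + 1) ≤ M :=
      (Multiset.le_iff_subset (Multiset.nodup_range _)).2 fun i hi =>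
        (hM i).2 (Nat.lt_succ_iff.1 (Multiset.mem_range.1 hi))
    obtain ⟨N, rfl⟩ := Multiset.le_iff_exists_add.1 hsub
    have hN : (N.map (Fin.ofNat (m + 1))).map Fin.val = N := by
      rw [Multiset.map_map]
      refine (Multiset.map_congr rfl fun i hi => ?_).trans (Multiset.map_id' N)
      exact Nat.mod_eq_of_lt (Nat.lt_succ_iff.2 ((hM i).1 (Multiset.mem_add.2 (.inr hi))))
    refine ⟨⟨N.map (Fin.ofNat (m + 1)), ?_⟩, congrArg _ hN⟩
    rw [Multiset.card_add, Multiset.card_range] at hcard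
    rw [Multiset.card_map]
    omega

/-- The pairs of a crossing number and a multiset of `K + 1` numbers of arcs over block minima
realised by partitions with `A` arcs. -/
def reachablePairs (A K : ℕ) : Finset (ℕ × Multiset ℕ) :=
  (range (K + 1)).biUnion fun m => range (maxCrossings A m + 1) ×ˢ intervalMultisets K m

theorem mem_reachablePairs {A K : ℕ} (hA : K ≤ A) {x : ℕ × Multiset ℕ} :
    x ∈ reachablePairs A K ↔
      ∃ u : List ℕ, Reachable A x.1 u ∧ (u : Multiset ℕ) = x.2 ∧ u.length = K + 1 := by
  obtain ⟨c, M⟩ := x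
  have hcard : (∃ u : List ℕ, Reachable A c u ∧ (u : Multiset ℕ) = M ∧ u.length = K + 1) ↔
      (∃ u : List ℕ, Reachable A c u ∧ (u : Multiset ℕ) = M) ∧ M.card = K + 1 := by
    constructor
    · rintro ⟨u, h, rfl, hu⟩
      exact ⟨⟨u, h, rfl⟩, hu⟩
    · rintro ⟨⟨u, h, rfl⟩, hu⟩
      exact ⟨u, h, rfl, hu⟩
  simp only [reachablePairs, mem_biUnion, mem_product, mem_range, Order.lt_add_one_iff]
  rw [hcard]
  constructor
  · rintro ⟨m, hm, hc, hM⟩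
    obtain ⟨hK, hM⟩ := (mem_intervalMultisets hm).1 hM
    refine ⟨(exists_reachable_iff ?_ (by omega)).2 ⟨m, hM, hc⟩, hK⟩
    rintro rfl
    simp at hK
  · rintro ⟨h, hK⟩
    obtain ⟨m, hM, hc⟩ := (exists_reachable_iff (by rintro rfl; simp at hK) (by omega)).1 h
    have hm : m ≤ K := by
      have hsub : Multiset.range (m + 1) ≤ M :=
        (Multiset.le_iff_subset (Multiset.nodup_range _)).2 fun i hi =>
          (hM i).2 (Nat.lt_succ_iff.1 (Multiset.mem_range.1 hi))
      simpa [hK] using Multiset.card_le_card hsub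
    exact ⟨m, hm, hc, (mem_intervalMultisets hm).2 ⟨hK, hM⟩⟩

theorem card_reachablePairs (A K : ℕ) :
    (reachablePairs A K).card = ∑ m ∈ range (K + 1), K.choose m * (maxCrossings A m + 1) := by
  rw [reachablePairs, card_biUnion]
  · refine sum_congr rfl fun m hm => ?_
    rw [card_product, card_range, card_intervalMultisets (Nat.lt_succ_iff.1 (mem_range.1 hm)),
      mul_comm]
  · intro m hm p hp hmp
    refine disjoint_left.2 fun x hx hx' => hmp ?_
    have h₁ := ((mem_intervalMultisets (Nat.lt_succ_iff.1 (mem_range.1 hm))).1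
      (mem_product.1 hx).2).2
    have h₂ := ((mem_intervalMultisets (Nat.lt_succ_iff.1 (mem_range.1 hp))).1
      (mem_product.1 hx').2).2
    exact le_antisymm ((h₂ m).1 ((h₁ m).2 le_rfl)) ((h₁ p).1 ((h₂ p).2 le_rfl))

theorem two_mul_maxCrossings {A m : ℕ} (h : m ≤ A) :
    (2 * maxCrossings A m : ℤ) = 2 * m * A - m * (m + 1) := by
  induction A, h using Nat.le_induction with
  | base =>
    have : maxCrossings m m = ∑ j ∈ range m, j :=
      sum_congr rfl fun j hj => min_eq_right (mem_range.1 hj).le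
    have h₂ := Finset.sum_range_id_mul_two m
    rw [this, mul_comm, ← Nat.cast_two, ← Nat.cast_mul, h₂]
    rcases m with _ | m
    · simp
    · push_cast [Nat.add_sub_cancel]
      ring
  | succ A hA ih =>
    rw [maxCrossings, sum_range_succ, ← maxCrossings, min_eq_left hA, Nat.cast_add, mul_add, ih]
    push_cast
    ring

theorem four_mul_sum_choose_mul_quadratic (K : ℕ) (a b c : ℤ) :
    4 * ∑ m ∈ range (K + 1), (K.choose m : ℤ) * (a + b * m + c * m ^ 2) =
      2 ^ K * (4 * a + 2 * b * K + c * (K + K ^ 2)) := by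
  induction K generalizing a b c with
  | zero => simp
  | succ K ih =>
    have h := sum_choose_succ_mul (fun i _ => a + b * (i : ℤ) + c * (i : ℤ) ^ 2) K
    rw [h, mul_add, ih]
    have h₂ : ∀ i : ℕ, a + b * ((i + 1 : ℕ) : ℤ) + c * ((i + 1 : ℕ) : ℤ) ^ 2 =
        (a + b + c) + (b + 2 * c) * i + c * (i : ℤ) ^ 2 := by
      intro i
      push_cast
      ring
    simp only [h₂]
    rw [ih]
    push_cast
    ring

theorem sixteen_mul_card_reachablePairs {A K : ℕ} (hA : K ≤ A) :
    (16 * (reachablePairs A K).card : ℤ) =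
      ((A : ℤ) - 1) * K * 2 ^ (K + 3) + 2 ^ (K + 4) - (K : ℤ) * (K - 1) * 2 ^ (K + 1) := by
  have h : ∑ m ∈ range (K + 1), (2 * ((K.choose m * (maxCrossings A m + 1) : ℕ) : ℤ)) =
      ∑ m ∈ range (K + 1), (K.choose m : ℤ) * (2 + (2 * A - 1) * m + (-1) * (m : ℤ) ^ 2) := by
    refine sum_congr rfl fun m hm => ?_
    have h₂ := two_mul_maxCrossings ((Nat.lt_succ_iff.1 (mem_range.1 hm)).trans hA)
    push_cast
    linear_combination (K.choose m : ℤ) * h₂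
  rw [card_reachablePairs, Nat.cast_sum]
  rw [← mul_sum] at h
  have h₄ := four_mul_sum_choose_mul_quadratic K 2 (2 * A - 1) (-1)
  rw [← h] at h₄
  linear_combination 2 * h₄

/-! ### The state of a partition -/

section Bridge

variable {n : ℕ}

theorem inSameBlock_iff_part_eq {p : SetPartition n} {i j : Fin n} :
    InSameBlock p i j ↔ p.part i = p.part j := by
  rw [← p.mem_part_iff_part_eq_part (mem_univ i) (mem_univ j), p.mem_part_iff_exists]
  rfl

theorem setPartition_ext {p q : SetPartition n}
    (h : ∀ i j, InSameBlock p i j ↔ InSameBlock q i j) : p = q := by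
  have hpart : ∀ i, p.part i = q.part i := fun i => by
    ext j
    rw [p.mem_part_iff_part_eq_part (mem_univ j) (mem_univ i),
      q.mem_part_iff_part_eq_part (mem_univ j) (mem_univ i), ← inSameBlock_iff_part_eq,
      ← inSameBlock_iff_part_eq, h]
  have hparts : ∀ r : SetPartition n, r.parts = univ.image r.part := fun r => by
    ext B
    simp only [mem_image, mem_univ, true_and]
    constructor
    · intro hB
      obtain ⟨b, hb⟩ := r.nonempty_of_mem_parts hB
      exact ⟨b, r.part_eq_of_mem hB hb⟩
    · rintro ⟨b, rfl⟩
      exact r.part_mem.2 (mem_univ b)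
  ext1
  rw [hparts, hparts, funext hpart]

theorem exists_setPartition {α : Type*} (f : Fin n → α) :
    ∃ p : SetPartition n, ∀ i j, InSameBlock p i j ↔ f i = f j := by
  classical
  refine ⟨Finpartition.ofSetoid (Setoid.ker f), fun i j => ?_⟩
  rw [inSameBlock_iff_part_eq, ← Finpartition.mem_part_iff_part_eq_part _ (mem_univ i)
    (mem_univ j), Finpartition.mem_part_ofSetoid_iff_rel, Setoid.ker_def, eq_comm]

theorem isArc_iff {p : SetPartition n} {i j : Fin n} :
    IsArc p i j ↔ i < j ∧ InSameBlock p i j ∧ ∀ x, i < x → x < j → ¬ InSameBlock p i x := by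
  constructor
  · rintro ⟨hij, B, hB, hi, hj, hx⟩
    refine ⟨hij, ⟨B, hB, hi, hj⟩, ?_⟩
    rintro x h₁ h₂ ⟨C, hC, hiC, hxC⟩
    obtain rfl := p.eq_of_mem_parts hB hC hi hiC
    exact hx x hxC ⟨h₁, h₂⟩
  · rintro ⟨hij, ⟨B, hB, hi, hj⟩, hx⟩
    exact ⟨hij, B, hB, hi, hj, fun x hxB h => hx x h.1 h.2 ⟨B, hB, hi, hxB⟩⟩

/-- `b` is the minimum of its block. -/
def IsBlockMin (p : SetPartition n) (b : Fin n) : Prop := ∀ i < b, ¬ InSameBlock p b i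

open Classical in
/-- The block minima of a partition in increasing order. -/
noncomputable def blockMins (p : SetPartition n) : List (Fin n) :=
  (List.finRange n).filter (IsBlockMin p)

/-- The state of a partition: its number of crossings and the numbers of arcs over its block
minima, from left to right. -/
noncomputable def state (p : SetPartition n) : ℕ × List ℕ :=
  (cr p, (blockMins p).map fun b : Fin n => uStat p b)

theorem mem_blockMins {p : SetPartition n} {b : Fin n} : b ∈ blockMins p ↔ IsBlockMin p b := by
  simp [blockMins]

theorem pairwise_blockMins (p : SetPartition n) : (blockMins p).Pairwise (· < ·) :=
  (List.pairwise_lt_finRange n).filter _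

theorem InSameBlock.eq_of_isBlockMin {p : SetPartition n} {b d : Fin n} (h : InSameBlock p b d)
    (hb : IsBlockMin p b) (hd : IsBlockMin p d) : b = d := by
  rcases lt_trichotomy b d with hbd | rfl | hbd
  · refine absurd ?_ (hd b hbd)
    rw [inSameBlock_iff_part_eq] at h ⊢
    exact h.symm
  · rfl
  · exact absurd h (hb d hbd)

theorem exists_isBlockMin (p : SetPartition n) (i : Fin n) :
    ∃ b, IsBlockMin p b ∧ InSameBlock p b i := by
  have hne : (p.part i).Nonempty := p.part_nonempty.2 (mem_univ i)
  have hmem : ∀ j, j ∈ p.part i ↔ InSameBlock p j i := fun j => by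
    rw [inSameBlock_iff_part_eq, p.mem_part_iff_part_eq_part (mem_univ j) (mem_univ i)]
  refine ⟨(p.part i).min' hne, fun j hj h => ?_, (hmem _).1 (min'_mem _ hne)⟩
  refine absurd (min'_le _ j ?_) (not_le.2 hj)
  have h₂ := (hmem _).1 (min'_mem _ hne)
  rw [hmem]
  rw [inSameBlock_iff_part_eq] at h h₂ ⊢
  rw [← h, h₂]

theorem length_blockMins (p : SetPartition n) : (blockMins p).length = p.parts.card := by
  have hnd : (blockMins p).Nodup := (pairwise_blockMins p).nodup
  rw [← List.toFinset_card_of_nodup hnd]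
  refine card_bij (fun b _ => p.part b) (fun b _ => p.part_mem.2 (mem_univ b)) ?_ ?_
  · intro b hb d hd h
    rw [List.mem_toFinset, mem_blockMins] at hb hd
    exact (inSameBlock_iff_part_eq.2 h).eq_of_isBlockMin hb hd
  · intro B hB
    obtain ⟨i, hi⟩ := p.nonempty_of_mem_parts hB
    obtain ⟨b, hb, hbi⟩ := exists_isBlockMin p i
    refine ⟨b, List.mem_toFinset.2 (mem_blockMins.2 hb), ?_⟩
    rw [inSameBlock_iff_part_eq.1 hbi]
    exact p.part_eq_of_mem hB hi

theorem length_state (p : SetPartition n) : (state p).2.length = p.parts.card := by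
  rw [state, List.length_map, length_blockMins]

/-! ### Children of a partition -/

/-- `c` is the child of `p` in which the new minimal element is attached to the block with minimum
`b` if `o = some b`, and forms a singleton block if `o = none`. -/
structure IsChildAt (c : SetPartition (n + 1)) (p : SetPartition n) (o : Option (Fin n)) :
    Prop where
  isChild : IsChild c p
  isBlockMin : ∀ b, o = some b → IsBlockMin p b
  zero_iff : ∀ j : Fin n, InSameBlock c 0 j.succ ↔ ∃ b, o = some b ∧ InSameBlock p b j

theorem exists_isChildAt (p : SetPartition n) {o : Option (Fin n)}
    (ho : ∀ b, o = some b → IsBlockMin p b) : ∃ c, IsChildAt c p o := by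
  obtain ⟨c, hc⟩ := exists_setPartition
    (Fin.cases (o.map p.part) fun i => some (p.part i) : Fin (n + 1) → Option (Finset (Fin n)))
  refine ⟨c, fun i j => ?_, ho, fun j => ?_⟩
  · simp [hc, inSameBlock_iff_part_eq]
  · simp [hc, inSameBlock_iff_part_eq]

theorem IsChild.exists_isChildAt {c : SetPartition (n + 1)} {p : SetPartition n}
    (h : IsChild c p) : ∃ o, IsChildAt c p o := by
  by_cases h₀ : ∃ i : Fin n, InSameBlock c 0 i.succ
  · obtain ⟨i, hi⟩ := h₀
    obtain ⟨b, hb, hbi⟩ := exists_isBlockMin p i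
    refine ⟨some b, h, by simpa using hb, fun j => ?_⟩
    rw [h b i] at hbi
    simp only [Option.some.injEq, exists_eq_left', h b j]
    rw [inSameBlock_iff_part_eq] at hi hbi ⊢
    rw [inSameBlock_iff_part_eq, hi, hbi]
  · exact ⟨none, h, by simp, fun j => by simpa using not_exists.1 h₀ j⟩

theorem InSameBlock.symm {p : SetPartition n} {i j : Fin n} (h : InSameBlock p i j) :
    InSameBlock p j i := by
  rw [inSameBlock_iff_part_eq] at h ⊢
  exact h.symm

theorem IsChildAt.unique {c d : SetPartition (n + 1)} {p : SetPartition n} {o : Option (Fin n)}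
    (hc : IsChildAt c p o) (hd : IsChildAt d p o) : c = d := by
  refine setPartition_ext fun i j => ?_
  have h₀ : ∀ j : Fin n, InSameBlock c 0 j.succ ↔ InSameBlock d 0 j.succ := fun j => by
    rw [hc.zero_iff, hd.zero_iff]
  cases i using Fin.cases with
  | zero =>
    cases j using Fin.cases with
    | zero => simp [inSameBlock_iff_part_eq]
    | succ j => exact h₀ j
  | succ i =>
    cases j using Fin.cases with
    | zero =>
      exact ⟨fun h => ((h₀ i).1 h.symm).symm, fun h => ((h₀ i).2 h.symm).symm⟩
    | succ j => rw [← hc.isChild, ← hd.isChild]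

theorem IsChildAt.option_eq {c : SetPartition (n + 1)} {p : SetPartition n} {o o' : Option (Fin n)}
    (h : IsChildAt c p o) (h' : IsChildAt c p o') : o = o' := by
  have key : ∀ {o o' : Option (Fin n)}, IsChildAt c p o → IsChildAt c p o' →
      ∀ b, o = some b → o' = some b := by
    rintro _ o' h h' b rfl
    have hb := h.isBlockMin b rfl
    obtain ⟨d, rfl, hd⟩ := (h'.zero_iff b).1 ((h.zero_iff b).2
      ⟨b, rfl, inSameBlock_iff_part_eq.2 rfl⟩)
    rw [hd.eq_of_isBlockMin (h'.isBlockMin d rfl) hb]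
  exact Option.ext fun b => ⟨key h h' b, key h' h b⟩

namespace IsChildAt

variable {c : SetPartition (n + 1)} {p : SetPartition n} {o : Option (Fin n)}

theorem isArc_succ_succ (h : IsChildAt c p o) {i j : Fin n} :
    IsArc c i.succ j.succ ↔ IsArc p i j := by
  rw [isArc_iff, isArc_iff, Fin.succ_lt_succ_iff, ← h.isChild]
  refine and_congr_right fun _ => and_congr_right fun _ => ?_
  rw [Fin.forall_fin_succ]
  simp [← h.isChild i _]

theorem isArc_zero_succ (h : IsChildAt c p o) {j : Fin n} :
    IsArc c 0 j.succ ↔ o = some j := by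
  simp only [isArc_iff, Fin.forall_fin_succ, h.zero_iff, Fin.succ_lt_succ_iff, Fin.succ_pos,
    true_and, lt_self_iff_false, false_imp_iff, forall_true_left]
  constructor
  · rintro ⟨⟨b, rfl, hbj⟩, hmin⟩
    obtain ⟨d, hd, hdj⟩ := exists_isBlockMin p j
    have hbd : b = d := by
      refine InSameBlock.eq_of_isBlockMin (p := p) ?_ (h.isBlockMin b rfl) hd
      rw [inSameBlock_iff_part_eq] at hbj hdj ⊢
      rw [hbj, hdj]
    subst hbd
    rcases lt_trichotomy b j with hlt | rfl | hlt
    · exact absurd ⟨b, rfl, inSameBlock_iff_part_eq.2 rfl⟩ (hmin b hlt)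
    · rfl
    · exact absurd hbj (hd j hlt)
  · rintro rfl
    refine ⟨⟨j, rfl, inSameBlock_iff_part_eq.2 rfl⟩, ?_⟩
    rintro i hi ⟨b, hb, hbi⟩
    obtain rfl := Option.some.inj hb
    exact h.isBlockMin j rfl i hi hbi

theorem isBlockMin_succ (h : IsChildAt c p o) {j : Fin n} :
    IsBlockMin c j.succ ↔ IsBlockMin p j ∧ o ≠ some j := by
  have h₀ : InSameBlock c j.succ 0 ↔ ∃ b, o = some b ∧ InSameBlock p b j := by
    rw [← h.zero_iff]
    exact ⟨InSameBlock.symm, InSameBlock.symm⟩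
  simp only [IsBlockMin, Fin.forall_fin_succ, Fin.succ_pos, forall_true_left,
    Fin.succ_lt_succ_iff, ← h.isChild j _, h₀]
  constructor
  · rintro ⟨h₁, h₂⟩
    exact ⟨h₂, fun ho => h₁ ⟨j, ho, inSameBlock_iff_part_eq.2 rfl⟩⟩
  · rintro ⟨h₁, h₂⟩
    refine ⟨?_, h₁⟩
    rintro ⟨b, rfl, hb⟩
    exact h₂ (congrArg some (hb.eq_of_isBlockMin (h.isBlockMin b rfl) h₁))

theorem not_isArc_to_zero {i : Fin (n + 1)} : ¬ IsArc c i 0 := fun h => Fin.not_lt_zero _ h.1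

theorem cr_eq (h : IsChildAt c p o) :
    cr c = cr p + (o.elim 0 fun b => uStat p b) := by
  set f : (Fin n × Fin n) × (Fin n × Fin n) → (Fin (n + 1) × Fin (n + 1)) ×
    (Fin (n + 1) × Fin (n + 1)) :=
    Prod.map (Prod.map Fin.succ Fin.succ) (Prod.map Fin.succ Fin.succ) with hf
  have hs : Function.Injective (Fin.succ : Fin n → Fin (n + 1)) := Fin.succ_injective n
  have hfinj : Function.Injective f := (hs.prodMap hs).prodMap (hs.prodMap hs)
  rcases o with _ | b
  · rw [Option.elim_none, add_zero, cr, cr, ← Set.ncard_image_of_injective _ hfinj]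
    congr 1
    ext ⟨⟨i, j⟩, ⟨k, l⟩⟩
    cases i using Fin.cases <;> cases j using Fin.cases <;> cases k using Fin.cases <;>
      cases l using Fin.cases <;>
      simp [hf, h.isArc_succ_succ, h.isArc_zero_succ, not_isArc_to_zero, Crossing,
        Fin.succ_ne_zero]
  · rw [Option.elim_some, cr, cr, uStat, ← Set.ncard_image_of_injective _ hfinj]
    set g : Fin n × Fin n → (Fin (n + 1) × Fin (n + 1)) × (Fin (n + 1) × Fin (n + 1)) :=
      fun e => ((0, b.succ), (e.1.succ, e.2.succ)) with hg
    have hginj : Function.Injective g := fun e e' he => by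
      simpa [hg, Prod.ext_iff] using he
    rw [← Set.ncard_image_of_injective _ hginj, ← Set.ncard_union_eq]
    · congr 1
      ext ⟨⟨i, j⟩, ⟨k, l⟩⟩
      cases i using Fin.cases <;> cases j using Fin.cases <;> cases k using Fin.cases <;>
        cases l using Fin.cases <;>
        simp [hf, hg, h.isArc_succ_succ, h.isArc_zero_succ, not_isArc_to_zero, Crossing,
          Fin.succ_ne_zero, (Fin.succ_ne_zero _).symm]
      grind
    · rw [Set.disjoint_left]
      rintro _ ⟨e, -, rfl⟩ ⟨e', -, he⟩
      simp [hf, hg, Prod.ext_iff] at he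
      exact absurd he.1.1 (Fin.succ_ne_zero _).symm

theorem uStat_succ (h : IsChildAt c p o) (j : ℕ) :
    uStat c (j + 1) = uStat p j + (o.elim 0 fun b => if j < b then 1 else 0) := by
  have hs : Function.Injective (Prod.map Fin.succ Fin.succ : Fin n × Fin n → _) :=
    (Fin.succ_injective n).prodMap (Fin.succ_injective n)
  have hset : {e : Fin (n + 1) × Fin (n + 1) | IsArc c e.1 e.2 ∧ (e.1 : ℕ) < j + 1 ∧
      j + 1 < (e.2 : ℕ)} = Prod.map Fin.succ Fin.succ ''
        {e : Fin n × Fin n | IsArc p e.1 e.2 ∧ (e.1 : ℕ) < j ∧ j < (e.2 : ℕ)} ∪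
        {e | e.1 = 0 ∧ ∃ b, o = some b ∧ j < b ∧ e.2 = b.succ} := by
    ext ⟨i, k⟩
    cases i using Fin.cases <;> cases k using Fin.cases <;>
      simp [h.isArc_succ_succ, h.isArc_zero_succ, not_isArc_to_zero, Fin.succ_ne_zero,
        (Fin.succ_ne_zero _).symm]
  rw [uStat, hset, Set.ncard_union_eq, Set.ncard_image_of_injective _ hs, uStat]
  · congr 1
    rcases o with _ | b
    · simp
    · by_cases hj : j < b
      · rw [Option.elim_some, if_pos hj, Set.ncard_eq_one]
        refine ⟨(0, b.succ), ?_⟩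
        ext ⟨i, k⟩
        simp [hj]
      · simp [hj]
  · rw [Set.disjoint_left]
    rintro _ ⟨e, -, rfl⟩ ⟨h₀, -⟩
    exact Fin.succ_ne_zero _ h₀

theorem blockMins_eq (h : IsChildAt c p o) :
    blockMins c = 0 :: ((blockMins p).filter fun j => o ≠ some j).map Fin.succ := by
  have h₀ : IsBlockMin c 0 := fun i hi => absurd hi (Fin.not_lt_zero i)
  rw [blockMins, blockMins, List.finRange_succ, List.filter_cons_of_pos (by simpa using h₀),
    List.filter_map, List.filter_filter]
  congr 3
  ext j
  rw [Bool.eq_iff_iff]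
  simp [h.isBlockMin_succ, and_comm]

theorem state_eq (h : IsChildAt c p o) :
    state c = (cr p + (o.elim 0 fun b => uStat p b),
      0 :: ((blockMins p).filter fun j => o ≠ some j).map fun j : Fin n =>
        uStat p j + (o.elim 0 fun b => if (j : ℕ) < b then 1 else 0)) := by
  have hu : uStat c 0 = 0 := by simp [uStat]
  rw [state, h.cr_eq, h.blockMins_eq]
  simp [hu, Function.comp_def, h.uStat_succ]

end IsChildAt

theorem removals_map {l : List (Fin n)} (hl : l.Pairwise (· < ·)) (u : Fin n → ℕ) :
    removals (l.map u) = l.map fun b =>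
      (u b, (l.filter fun j => b ≠ j).map fun j => u j + if (j : ℕ) < b then 1 else 0) := by
  induction l with
  | nil => rfl
  | cons a l ih =>
    rw [List.pairwise_cons] at hl
    have hfilter : (l.filter fun j => a ≠ j) = l :=
      List.filter_eq_self.2 fun b hb => by simpa using (hl.1 b hb).ne
    simp only [List.map_cons, removals, ih hl.2, List.map_map]
    congr 1
    · rw [List.filter_cons_of_neg (by simp), hfilter]
      refine congrArg _ (List.map_congr_left fun j hj => ?_)
      simp [(hl.1 j hj).le]
    · refine List.map_congr_left fun b hb => ?_
      have hab := hl.1 b hb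
      rw [List.filter_cons_of_pos (by simpa using hab.ne')]
      simp [hab]

/-- The child of `p` in which the new minimal element is attached as prescribed by `o`. -/
noncomputable def childAt (p : SetPartition n) (o : Option (Fin n)) : SetPartition (n + 1) :=
  Classical.epsilon fun c => IsChildAt c p o

/-- The list of the children of a partition. -/
noncomputable def children (p : SetPartition n) : List (SetPartition (n + 1)) :=
  (none :: (blockMins p).map some).map (childAt p)

theorem isChildAt_childAt {p : SetPartition n} {o : Option (Fin n)}
    (ho : o ∈ none :: (blockMins p).map some) : IsChildAt (childAt p o) p o := by
  refine Classical.epsilon_spec (exists_isChildAt p ?_)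
  rintro b rfl
  simpa [mem_blockMins] using ho

theorem mem_children {p : SetPartition n} {c : SetPartition (n + 1)} :
    c ∈ children p ↔ IsChild c p := by
  rw [children, List.mem_map]
  constructor
  · rintro ⟨o, ho, rfl⟩
    exact (isChildAt_childAt ho).isChild
  · intro h
    obtain ⟨o, ho⟩ := h.exists_isChildAt
    have hmem : o ∈ none :: (blockMins p).map some := by
      rcases o with _ | b
      · simp
      · simpa [mem_blockMins] using ho.isBlockMin b rfl
    exact ⟨o, hmem, (isChildAt_childAt hmem).unique ho⟩

theorem nodup_children (p : SetPartition n) : (children p).Nodup := by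
  refine List.Nodup.map_on (fun o ho o' ho' h => ?_) ?_
  · have h' := isChildAt_childAt ho'
    rw [← h] at h'
    exact (isChildAt_childAt ho).option_eq h'
  · rw [List.nodup_cons]
    exact ⟨by simp, (pairwise_blockMins p).nodup.map (Option.some_injective _)⟩

theorem map_state_children (p : SetPartition n) :
    (children p).map state = childStates (state p) := by
  have h := List.map_congr_left fun o ho => (isChildAt_childAt (p := p) (o := o) ho).state_eq
  rw [children, List.map_map, Function.comp_def, h, childStates, state,
    removals_map (pairwise_blockMins p)]
  simp [Function.comp_def]

/-! ### Descendants of a partition -/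

/-- The list of the descendants of a partition at a given level. -/
noncomputable def levelList (p : SetPartition n) : (l : ℕ) → List (SetPartition (n + l))
  | 0 => [p]
  | l + 1 => (levelList p l).flatMap children

theorem mem_levelList {p : SetPartition n} {l : ℕ} {t : SetPartition (n + l)} :
    t ∈ levelList p l ↔ t ∈ level p l := by
  induction l with
  | zero => simp [levelList, level]
  | succ l ih => simp [levelList, level, ih, mem_children]

theorem IsChild.eq {c : SetPartition (n + 1)} {p q : SetPartition n} (hp : IsChild c p)
    (hq : IsChild c q) : p = q :=
  setPartition_ext fun i j => (hp i j).trans (hq i j).symm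

theorem nodup_levelList (p : SetPartition n) (l : ℕ) : (levelList p l).Nodup := by
  induction l with
  | zero => simp [levelList]
  | succ l ih =>
    refine List.nodup_flatMap.2 ⟨fun q _ => nodup_children q, ih.imp fun hne c hc hc' => ?_⟩
    exact hne ((mem_children.1 hc).eq (mem_children.1 hc'))

theorem map_state_levelList (p : SetPartition n) (l : ℕ) :
    (levelList p l).map state = descendantStates (state p) l := by
  induction l with
  | zero => rfl
  | succ l ih =>
    rw [levelList, descendantStates, ← ih, List.map_flatMap, List.flatMap_map]
    simp only [map_state_children]

theorem ncard_level (p : SetPartition n) (l m d : ℕ) :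
    {t ∈ level p l | t.parts.card = m ∧ cr t = d}.ncard =
      (descendantStates (state p) l).countP fun s => s.2.length = m ∧ s.1 = d := by
  classical
  rw [← map_state_levelList, List.countP_map, List.countP_eq_length_filter,
    ← List.toFinset_card_of_nodup ((nodup_levelList p l).filter _), ← Set.ncard_coe_finset]
  congr 1
  ext t
  have hcr : (state t).1 = cr t := rfl
  simp [mem_levelList, length_state, hcr]

theorem simCr_iff {p q : SetPartition n} (h : p.parts.card = q.parts.card) :
    SimCr p q ↔ cr p = cr q ∧ ((state p).2 : Multiset ℕ) = (state q).2 := by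
  simp only [SimCr, ncard_level, Multiset.coe_eq_coe]
  refine ⟨fun hpq => perm_of_countP_descendantStates ?_ hpq, fun ⟨hcr, hu⟩ l m d => ?_⟩
  · rw [length_state, length_state, h]
  · rw [state, hcr]
    exact countP_descendantStates_of_perm hu l m d

/-! ### Counting the classes -/

theorem exists_reachable_state {n : ℕ} (p : SetPartition n) :
    ∃ A, Reachable A (state p).1 (state p).2 ∧ A + (state p).2.length = n := by
  induction n with
  | zero =>
    have hs : state p = (0, []) := by
      simp [state, cr, blockMins, Set.eq_empty_of_isEmpty]
    exact ⟨0, by rw [hs]; exact Reachable.nil, by simp [hs]⟩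
  | succ n ih =>
    obtain ⟨q, hq⟩ := exists_setPartition fun i : Fin n => p.part i.succ
    have hp : IsChild p q := fun i j => by rw [hq, inSameBlock_iff_part_eq]
    obtain ⟨A, hA, hn⟩ := ih q
    have hmem : state p ∈ childStates (state q) := by
      rw [← map_state_children]
      exact List.mem_map_of_mem (mem_children.2 hp)
    obtain ⟨B, hB, hBn⟩ := hA.of_mem_childStates hmem
    exact ⟨B, hB, by omega⟩

theorem Reachable.exists_state {A c : ℕ} {u : List ℕ} (h : Reachable A c u) {n : ℕ}
    (hn : n = A + u.length) : ∃ p : SetPartition n, state p = (c, u) := by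
  have step : ∀ {n : ℕ} {p : SetPartition n} {s : ℕ × List ℕ}, s ∈ childStates (state p) →
      ∃ q : SetPartition (n + 1), state q = s := fun {n p s} hs => by
    rw [← map_state_children] at hs
    obtain ⟨q, -, hq⟩ := List.mem_map.1 hs
    exact ⟨q, hq⟩
  induction h generalizing n with
  | nil =>
    obtain rfl : n = 0 := hn
    exact ⟨⊥, by simp [state, cr, blockMins, Set.eq_empty_of_isEmpty]⟩
  | @single A c u h ih =>
    obtain ⟨p, hp⟩ := ih rfl
    obtain rfl : n = A + u.length + 1 := hn
    exact step (p := p) (by simp [hp, childStates])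
  | @join A c u₁ a u₂ h ih =>
    obtain ⟨p, hp⟩ := ih rfl
    obtain rfl : n = A + (u₁ ++ a :: u₂).length + 1 := by
      rw [hn]
      simp
      omega
    refine step (p := p) ?_
    rw [hp, childStates, List.mem_cons, List.mem_map]
    exact Or.inr ⟨(a, u₁.map Nat.succ ++ u₂), mem_removals.2 ⟨u₁, u₂, rfl, rfl⟩, rfl⟩

end Bridge

/-- The invariant classifying partitions up to `SimCr`. -/
noncomputable def crInvariant {n k : ℕ} (p : {p : SetPartition n // p.parts.card = k}) :
    ℕ × Multiset ℕ :=
  (cr p.1, (state p.1).2)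

theorem crSetoid_eq_ker (n k : ℕ) : crSetoid n k = Setoid.ker crInvariant := by
  ext p q
  rw [Setoid.ker_def, crInvariant, crInvariant, Prod.mk.injEq]
  exact simCr_iff (p.2.trans q.2.symm)

theorem range_crInvariant {A K : ℕ} (hA : K ≤ A) :
    Set.range (crInvariant (n := A + (K + 1)) (k := K + 1)) = reachablePairs A K := by
  ext x
  rw [mem_coe, mem_reachablePairs hA]
  constructor
  · rintro ⟨⟨p, hp⟩, rfl⟩
    have hlen := length_state p
    obtain ⟨B, hB, hBn⟩ := exists_reachable_state p
    obtain rfl : B = A := by omega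
    exact ⟨_, hB, rfl, by omega⟩
  · rintro ⟨u, hu, hux, hlen⟩
    obtain ⟨p, hp⟩ := hu.exists_state (by rw [hlen])
    have hpk : p.parts.card = K + 1 := by rw [← length_state, hp, hlen]
    have hp₂ : (state p).2 = u := by rw [hp]
    refine ⟨⟨p, hpk⟩, Prod.ext (congrArg Prod.fst hp : (state p).1 = x.1) ?_⟩
    rw [← hux, ← hp₂, crInvariant]

/-- Theorem 4.5, eq. (20). For `k ≥ 1` and `n ≥ 2k-1`, the number `N`
of `∼_cr`-equivalence classes on `Π_{n,k}` satisfies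
`16·N = (n-k-1)(k-1)·2^{k+2} + 2^{k+3} - (k-1)(k-2)·2^k` (as integers), i.e.
`N = (n-k-1)(k-1)2^{k-2} + 2^{k-1} - (k-1)(k-2)2^{k-4}`. -/
theorem statement16 {n k : ℕ} (hk : 1 ≤ k) (hn : 2 * k - 1 ≤ n) :
    (16 * Nat.card (Quotient (crSetoid n k)) : ℤ) =
      ((n : ℤ) - k - 1) * ((k : ℤ) - 1) * 2 ^ (k + 2) + 2 ^ (k + 3)
        - ((k : ℤ) - 1) * ((k : ℤ) - 2) * 2 ^ k := by
  obtain ⟨K, rfl⟩ : ∃ K, k = K + 1 := ⟨k - 1, by omega⟩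
  obtain ⟨A, rfl⟩ : ∃ A, n = A + (K + 1) := ⟨n - (K + 1), by omega⟩
  have hA : K ≤ A := by omega
  have hcard : Nat.card (Quotient (crSetoid (A + (K + 1)) (K + 1))) =
      (reachablePairs A K).card := by
    rw [crSetoid_eq_ker, Nat.card_congr (Setoid.quotientKerEquivRange _), range_crInvariant hA,
      Nat.card_coe_set_eq, Set.ncard_coe_finset]
  have h := sixteen_mul_card_reachablePairs hA
  rw [hcard, h]
  push_cast
  ring
end

section
/- Let F_n denote the number of equivalence classes of the relation ∼_ne on Π_n. Then F_1 = 1, F_2 = 2, and for every n ≥ 3, 32·F_n = 2^n·(n² − 5n + 22) (equivalently, F_n = 2^{n−5}(n² − 5n + 22) as rational numbers). -/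
open Finset

/-- `F_n`: the number of `∼_ne`-equivalence classes on `Π_n`. -/
noncomputable def Fcl (n : ℕ) : ℕ :=
  Nat.card (Quotient (neSetoidAll n))

namespace SetPartition

variable {n : ℕ}

theorem inSameBlock_iff (p : SetPartition n) (i j : Fin n) :
    InSameBlock p i j ↔ p.part i = p.part j := by
  rw [← p.mem_part_iff_part_eq_part (mem_univ i) (mem_univ j), p.mem_part_iff_exists]
  rfl

theorem ext_inSameBlock {p q : SetPartition n}
    (h : ∀ i j, InSameBlock p i j ↔ InSameBlock q i j) : p = q := by
  have hpart : ∀ i, p.part i = q.part i := by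
    intro i
    ext j
    rw [p.mem_part_iff_exists, q.mem_part_iff_exists]
    exact h j i
  ext B
  constructor
  · intro hB
    obtain ⟨x, hx⟩ := p.nonempty_of_mem_parts hB
    rw [← p.part_eq_of_mem hB hx, hpart]
    exact q.part_mem.2 (mem_univ x)
  · intro hB
    obtain ⟨x, hx⟩ := q.nonempty_of_mem_parts hB
    rw [← q.part_eq_of_mem hB hx, ← hpart]
    exact p.part_mem.2 (mem_univ x)

theorem isArc_iff (p : SetPartition n) (i j : Fin n) :
    IsArc p i j ↔ i < j ∧ p.part i = p.part j ∧
      ∀ x, p.part x = p.part i → i < x → j ≤ x := by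
  unfold IsArc
  refine and_congr_right fun _ => ⟨?_, ?_⟩
  · rintro ⟨B, hB, hi, hj, h⟩
    rw [p.part_eq_of_mem hB hi, p.part_eq_of_mem hB hj]
    refine ⟨rfl, fun x hx hix => ?_⟩
    have := h x ((p.part_eq_iff_mem hB).1 hx)
    grind
  · rintro ⟨hij, h⟩
    refine ⟨p.part i, p.part_mem.2 (mem_univ i), p.mem_part (mem_univ i), ?_, ?_⟩
    · rw [hij]; exact p.mem_part (mem_univ j)
    · intro x hx
      rw [p.mem_part_iff_part_eq_part (mem_univ x) (mem_univ i)] at hx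
      have := h x hx
      grind

/-- The partition of `[n]` into the nonempty fibres of a map. -/
noncomputable def ofMap {α : Type*} (f : Fin n → α) : SetPartition n :=
  letI := Classical.decRel (Setoid.ker f).r
  Finpartition.ofSetoid (Setoid.ker f)

theorem part_ofMap {α : Type*} (f : Fin n → α) (i j : Fin n) :
    (ofMap f).part i = (ofMap f).part j ↔ f i = f j := by
  classical
  rw [← (ofMap f).mem_part_iff_part_eq_part (mem_univ i) (mem_univ j)]
  unfold ofMap
  rw [Finpartition.mem_part_ofSetoid_iff_rel, Setoid.ker_def, eq_comm]

/-- The partition obtained by deleting the first element. -/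
noncomputable def parent (c : SetPartition (n + 1)) : SetPartition n :=
  ofMap fun i => c.part i.succ

theorem part_parent (c : SetPartition (n + 1)) (i j : Fin n) :
    (parent c).part i = (parent c).part j ↔ c.part i.succ = c.part j.succ :=
  part_ofMap _ i j

theorem isChild_iff (c : SetPartition (n + 1)) (p : SetPartition n) :
    IsChild c p ↔ parent c = p := by
  unfold IsChild
  constructor
  · intro h
    refine ext_inSameBlock fun i j => ?_
    rw [h, inSameBlock_iff, inSameBlock_iff, part_parent]
  · rintro rfl i j
    rw [inSameBlock_iff, inSameBlock_iff, part_parent]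

theorem IsArc.right_unique {p : SetPartition n} {i j k : Fin n} (hj : IsArc p i j)
    (hk : IsArc p i k) : j = k := by
  rw [isArc_iff] at hj hk
  exact le_antisymm (hj.2.2 k hk.2.1.symm hk.1) (hk.2.2 j hj.2.1.symm hj.1)

theorem IsArc.left_unique {p : SetPartition n} {i j k : Fin n} (hi : IsArc p i k)
    (hj : IsArc p j k) : i = j := by
  rw [isArc_iff] at hi hj
  have h : p.part i = p.part j := hi.2.1.trans hj.2.1.symm
  rcases lt_trichotomy i j with hlt | heq | hlt
  · exact absurd (hi.2.2 j h.symm hlt) (not_le.2 hj.1)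
  · exact heq
  · exact absurd (hj.2.2 i h hlt) (not_le.2 hi.1)

open Classical in
/-- The end of the arc starting at the first element, if there is one. -/
noncomputable def tag (c : SetPartition (n + 1)) : Option (Fin n) :=
  if h : ∃ j : Fin n, IsArc c 0 j.succ then some h.choose else none

theorem tag_eq_some_iff (c : SetPartition (n + 1)) (j : Fin n) :
    tag c = some j ↔ IsArc c 0 j.succ := by
  unfold tag
  split_ifs with h
  · have hc := h.choose_spec
    constructor
    · rintro h'
      rw [Option.some_inj] at h'
      rwa [← h']
    · intro hj
      rw [Option.some_inj]
      exact Fin.succ_injective _ (IsArc.right_unique hc hj)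
  · simp only [false_iff]
    exact fun hj => h ⟨j, hj⟩

/-- The indicator word of the block minima. -/
noncomputable def minWord (p : SetPartition n) (i : Fin n) : Bool :=
  decide (∀ j, p.part j = p.part i → i ≤ j)

theorem minWord_eq_true_iff (p : SetPartition n) (i : Fin n) :
    minWord p i = true ↔ ∀ j, p.part j = p.part i → i ≤ j := by
  simp [minWord]

/-- The child of `p` whose first element is joined to the block of `b` when `o = some b`, and
is a singleton when `o = none`. -/
noncomputable def child (p : SetPartition n) (o : Option (Fin n)) : SetPartition (n + 1) :=
  ofMap (Fin.cons (o.map p.part) fun j => some (p.part j) : Fin (n + 1) → Option (Finset (Fin n)))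

theorem part_child_succ (p : SetPartition n) (o : Option (Fin n)) (i j : Fin n) :
    (child p o).part i.succ = (child p o).part j.succ ↔ p.part i = p.part j := by
  rw [child, part_ofMap]; simp

theorem part_child_zero (p : SetPartition n) (o : Option (Fin n)) (j : Fin n) :
    (child p o).part 0 = (child p o).part j.succ ↔ o.map p.part = some (p.part j) := by
  rw [child, part_ofMap]; simp

theorem parent_child (p : SetPartition n) (o : Option (Fin n)) : parent (child p o) = p := by
  refine ext_inSameBlock fun i j => ?_
  rw [inSameBlock_iff, inSameBlock_iff, part_parent, part_child_succ]

theorem isArc_child_zero (p : SetPartition n) {o : Option (Fin n)}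
    (ho : ∀ b ∈ o, minWord p b = true) (j : Fin n) :
    IsArc (child p o) 0 j.succ ↔ o = some j := by
  rw [isArc_iff, part_child_zero]
  rcases o with _ | b
  · simp
  · have hb := (minWord_eq_true_iff p b).1 (ho b rfl)
    simp only [Fin.succ_pos, true_and, Option.map_some, Option.some_inj]
    constructor
    · rintro ⟨h1, h2⟩
      have h3 := h2 b.succ ((part_child_zero p _ b).2 rfl).symm (Fin.succ_pos b)
      exact le_antisymm (hb j h1.symm) (Fin.succ_le_succ_iff.1 h3)
    · rintro rfl
      refine ⟨rfl, fun x => Fin.cases (by simp) (fun x hx _ => ?_) x⟩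
      rw [eq_comm, part_child_zero] at hx
      simp only [Option.map_some, Option.some_inj] at hx
      exact Fin.succ_le_succ_iff.2 (hb x hx.symm)

theorem tag_child (p : SetPartition n) {o : Option (Fin n)}
    (ho : ∀ b ∈ o, minWord p b = true) : tag (child p o) = o := by
  ext j
  rw [tag_eq_some_iff, isArc_child_zero p ho]

theorem minWord_of_mem_tag (c : SetPartition (n + 1)) :
    ∀ b ∈ tag c, minWord (parent c) b = true := by
  intro b hb
  rw [Option.mem_def, tag_eq_some_iff, isArc_iff] at hb
  rw [minWord_eq_true_iff]
  intro j hj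
  rw [part_parent] at hj
  exact Fin.succ_le_succ_iff.1 (hb.2.2 j.succ (hj.trans hb.2.1.symm) (Fin.succ_pos j))

theorem part_zero_eq_iff (c : SetPartition (n + 1)) (j : Fin n) :
    c.part 0 = c.part j.succ ↔ ∃ b ∈ tag c, c.part b.succ = c.part j.succ := by
  classical
  constructor
  · intro h
    obtain ⟨b, hb, hmin⟩ := (univ.filter fun i : Fin n => c.part 0 = c.part i.succ).exists_minimal
      ⟨j, by simpa using h⟩
    simp only [mem_filter, mem_univ, true_and] at hb hmin
    refine ⟨b, ?_, hb.symm.trans h⟩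
    rw [Option.mem_def, tag_eq_some_iff, isArc_iff]
    refine ⟨Fin.succ_pos b, hb, fun x => Fin.cases (by simp) (fun x hx _ => ?_) x⟩
    rw [Fin.succ_le_succ_iff]
    by_contra hlt
    exact hlt (hmin hx.symm (not_le.1 hlt).le)
  · rintro ⟨b, hb, h⟩
    rw [Option.mem_def, tag_eq_some_iff, isArc_iff] at hb
    exact hb.2.1.trans h

theorem child_parent_tag (c : SetPartition (n + 1)) : child (parent c) (tag c) = c := by
  have hzero : ∀ j : Fin n, (child (parent c) (tag c)).part 0 =
      (child (parent c) (tag c)).part j.succ ↔ c.part 0 = c.part j.succ := by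
    intro j
    rw [part_child_zero, part_zero_eq_iff, Option.map_eq_some_iff]
    simp only [part_parent, Option.mem_def]
  refine ext_inSameBlock fun i j => ?_
  rw [inSameBlock_iff, inSameBlock_iff]
  refine Fin.cases ?_ (fun i => ?_) i <;> refine Fin.cases ?_ (fun j => ?_) j
  · simp
  · exact hzero j
  · rw [eq_comm, hzero, eq_comm]
  · rw [part_child_succ, part_parent]

theorem minWord_child (p : SetPartition n) {o : Option (Fin n)}
    (ho : ∀ b ∈ o, minWord p b = true) :
    minWord (child p o) = Fin.cons true
      (o.elim (minWord p) fun b => Function.update (minWord p) b false) := by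
  funext i
  rw [Bool.eq_iff_iff]
  refine Fin.cases ?_ (fun i => ?_) i
  · simp [minWord_eq_true_iff]
  · rw [Fin.cons_succ, minWord_eq_true_iff, Fin.forall_fin_succ, part_child_zero]
    simp only [part_child_succ, Fin.succ_le_succ_iff, Fin.le_zero_iff, Fin.succ_ne_zero]
    rw [← minWord_eq_true_iff]
    rcases o with _ | b
    · simp
    · have hb := (minWord_eq_true_iff p b).1 (ho b rfl)
      simp only [Option.map_some, Option.some_inj, Option.elim_some, Function.update_apply]
      split_ifs with hi
      · simp [hi]
      · simp only [imp_false, and_iff_right_iff_imp]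
        intro hw heq
        rw [minWord_eq_true_iff] at hw
        exact hi (le_antisymm (hw b heq) (hb i heq.symm))

theorem card_parts (p : SetPartition n) :
    p.parts.card = #{i | minWord p i = true} := by
  symm
  refine card_bij (fun i _ => p.part i) (fun i _ => p.part_mem.2 (mem_univ i)) ?_ ?_
  · intro i hi j hj h
    simp only [mem_filter, mem_univ, true_and, minWord_eq_true_iff] at hi hj
    exact le_antisymm (hi j h.symm) (hj i h)
  · intro B hB
    have hne := p.nonempty_of_mem_parts hB
    refine ⟨B.min' hne, ?_, p.part_eq_of_mem hB (B.min'_mem hne)⟩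
    simp only [mem_filter, mem_univ, true_and, minWord_eq_true_iff]
    intro j hj
    rw [p.part_eq_of_mem hB (B.min'_mem hne), p.part_eq_iff_mem hB] at hj
    exact B.min'_le j hj

/-- The number of letters `false` of `w` to the left of position `b`. -/
def cost (w : Fin n → Bool) (b : Fin n) : ℕ :=
  #{y | y < b ∧ w y = false}

theorem ncard_arcs_lt (p : SetPartition n) (b : Fin n) :
    {e : Fin n × Fin n | IsArc p e.1 e.2 ∧ e.2 < b}.ncard = cost (minWord p) b := by
  classical
  rw [cost, ← Set.ncard_coe_finset]
  refine Set.ncard_congr (fun e _ => e.2) ?_ ?_ ?_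
  · rintro ⟨x, y⟩ ⟨h, hb⟩
    rw [isArc_iff] at h
    have : ¬ minWord p y = true := fun hy =>
      absurd ((minWord_eq_true_iff p y).1 hy x h.2.1) (not_le.2 h.1)
    simpa [hb] using this
  · rintro ⟨x, y⟩ ⟨x', y'⟩ ⟨h, -⟩ ⟨h', -⟩ (rfl : y = y')
    exact congrArg (·, y) (IsArc.left_unique h h')
  · intro y hy
    simp only [coe_filter, mem_univ, true_and, Set.mem_ofPred_eq] at hy
    have hw : ¬ minWord p y = true := by simp [hy.2]
    rw [minWord_eq_true_iff] at hw
    push Not at hw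
    obtain ⟨j, hj, hjy⟩ := hw
    obtain ⟨x, hx, hmax⟩ := (univ.filter fun i => p.part i = p.part y ∧ i < y).exists_maximal
      ⟨j, by simp [hj, hjy]⟩
    simp only [mem_filter, mem_univ, true_and] at hx hmax
    refine ⟨(x, y), ⟨?_, hy.1⟩, rfl⟩
    rw [isArc_iff]
    refine ⟨hx.2, hx.1, fun z hz hxz => ?_⟩
    by_contra hzy
    exact absurd (hmax ⟨hz.trans hx.1, not_le.1 hzy⟩ hxz.le) (not_le.2 hxz)

theorem isArc_child_succ (p : SetPartition n) (o : Option (Fin n)) (i j : Fin n) :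
    IsArc (child p o) i.succ j.succ ↔ IsArc p i j := by
  rw [isArc_iff, isArc_iff, Fin.forall_fin_succ]
  simp [part_child_succ]

theorem ne'_child (p : SetPartition n) {o : Option (Fin n)}
    (ho : ∀ b ∈ o, minWord p b = true) :
    ne' (child p o) = ne' p + o.elim 0 (cost (minWord p)) := by
  classical
  have hsplit : {e : (Fin (n + 1) × Fin (n + 1)) × (Fin (n + 1) × Fin (n + 1)) |
      IsArc (child p o) e.1.1 e.1.2 ∧ IsArc (child p o) e.2.1 e.2.2 ∧ Nesting e.1 e.2} =
      (fun e : (Fin n × Fin n) × (Fin n × Fin n) =>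
        ((e.1.1.succ, e.1.2.succ), (e.2.1.succ, e.2.2.succ))) ''
        {e | IsArc p e.1.1 e.1.2 ∧ IsArc p e.2.1 e.2.2 ∧ Nesting e.1 e.2} ∪
      {e | e.1.1 = 0 ∧ IsArc (child p o) e.1.1 e.1.2 ∧ IsArc (child p o) e.2.1 e.2.2 ∧
        Nesting e.1 e.2} := by
    ext ⟨⟨a, b⟩, c, d⟩
    simp only [Set.mem_ofPred_eq, Set.mem_union, Set.mem_image, Prod.exists, Prod.mk.injEq]
    constructor
    · rintro ⟨h1, h2, h3⟩
      rcases Fin.eq_zero_or_eq_succ a with rfl | ⟨a, rfl⟩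
      · exact Or.inr ⟨rfl, h1, h2, h3⟩
      · left
        obtain ⟨b, rfl⟩ := Fin.exists_succ_eq.2 (Fin.pos_iff_ne_zero.1 (h1.1.pos))
        obtain ⟨c, rfl⟩ := Fin.exists_succ_eq.2 (Fin.pos_iff_ne_zero.1 (h3.1.pos))
        obtain ⟨d, rfl⟩ := Fin.exists_succ_eq.2 (Fin.pos_iff_ne_zero.1 (h2.1.pos))
        rw [isArc_child_succ] at h1 h2
        exact ⟨a, b, c, d, ⟨h1, h2, by simpa [Nesting] using h3⟩, by simp⟩
    · rintro (⟨a', b', c', d', ⟨h1, h2, h3⟩, ⟨rfl, rfl⟩, rfl, rfl⟩ | h)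
      · rw [isArc_child_succ, isArc_child_succ]
        exact ⟨h1, h2, by simpa [Nesting] using h3⟩
      · exact h.2
  rw [ne', hsplit, Set.ncard_union_eq, Set.ncard_image_of_injective, ← ne']
  · congr 1
    rcases o with _ | b
    · rw [Option.elim_none, Set.ncard_eq_zero]
      ext ⟨⟨x, y⟩, z, t⟩
      simp only [Set.mem_ofPred_eq, Set.mem_empty_iff_false, iff_false]
      rintro ⟨rfl, h1, -⟩
      obtain ⟨y, rfl⟩ := Fin.exists_succ_eq.2 (Fin.pos_iff_ne_zero.1 (h1.1.pos))
      rw [isArc_child_zero p ho] at h1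
      simp at h1
    · rw [Option.elim_some, ← ncard_arcs_lt]
      symm
      refine Set.ncard_congr (fun e _ => ((0, b.succ), (e.1.succ, e.2.succ))) ?_ ?_ ?_
      · rintro ⟨x, y⟩ ⟨h, hb⟩
        refine ⟨rfl, (isArc_child_zero p ho b).2 rfl, (isArc_child_succ p _ _ _).2 h, ?_⟩
        simpa [Nesting] using ⟨h.1, hb⟩
      · rintro ⟨x, y⟩ ⟨x', y'⟩ _ _ h
        simpa using h
      · rintro ⟨⟨x, y⟩, z, t⟩ ⟨h0, h1, h2, h3⟩
        dsimp only at h0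
        subst h0
        obtain ⟨y, rfl⟩ := Fin.exists_succ_eq.2 (Fin.pos_iff_ne_zero.1 (h1.1.pos))
        obtain ⟨z, rfl⟩ := Fin.exists_succ_eq.2 (Fin.pos_iff_ne_zero.1 (h3.1.pos))
        obtain ⟨t, rfl⟩ := Fin.exists_succ_eq.2 (Fin.pos_iff_ne_zero.1 (h2.1.pos))
        rw [isArc_child_zero p ho, Option.some_inj] at h1
        subst h1
        rw [isArc_child_succ] at h2
        exact ⟨(z, t), ⟨h2, by simpa [Nesting] using h3.2.2⟩, rfl⟩
  · rintro ⟨⟨a, b⟩, c, d⟩ ⟨⟨a', b'⟩, c', d'⟩ h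
    simpa using h
  · rw [Set.disjoint_left]
    rintro _ ⟨e, -, rfl⟩ ⟨h, -⟩
    exact Fin.succ_ne_zero _ h

theorem minWord_zero (p : SetPartition (n + 1)) : minWord p 0 = true := by
  simp [minWord_eq_true_iff]

/-- Partitions with the same word of minima and the same number of nestings have isomorphic
trees of descendants, as far as these two statistics are concerned. -/
theorem exists_level_map {p q : SetPartition n} (hw : minWord p = minWord q)
    (hne : ne' p = ne' q) (l : ℕ) :
    ∃ f : SetPartition (n + l) → SetPartition (n + l),
      Set.MapsTo f (level p l) (level q l) ∧ Set.InjOn f (level p l) ∧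
      ∀ t ∈ level p l, minWord (f t) = minWord t ∧ ne' (f t) = ne' t := by
  induction l with
  | zero =>
    refine ⟨fun _ => q, fun _ _ => rfl, ?_, ?_⟩
    · rintro a rfl b rfl _
      rfl
    · rintro t rfl
      exact ⟨hw.symm, hne.symm⟩
  | succ l ih =>
    obtain ⟨f, hmaps, hinj, hdata⟩ := ih
    have hmem : ∀ c ∈ level p (l + 1), parent c ∈ level p l := by
      rintro c ⟨r, hr, hc⟩
      rwa [(isChild_iff c r).1 hc]
    have htag : ∀ c ∈ level p (l + 1), ∀ b ∈ tag c, minWord (f (parent c)) b = true := by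
      intro c hc b hb
      rw [(hdata _ (hmem c hc)).1]
      exact minWord_of_mem_tag c b hb
    refine ⟨fun c => child (f (parent c)) (tag c), ?_, ?_, ?_⟩
    · intro c hc
      exact ⟨f (parent c), hmaps (hmem c hc), (isChild_iff _ _).2 (parent_child _ _)⟩
    · intro c hc d hd h
      have h1 := congrArg parent h
      have h2 := congrArg tag h
      simp only [parent_child] at h1
      dsimp only at h2
      rw [tag_child _ (htag c hc), tag_child _ (htag d hd)] at h2
      rw [← child_parent_tag c, ← child_parent_tag d, h2, hinj (hmem c hc) (hmem d hd) h1]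
    · intro c hc
      obtain ⟨h1, h2⟩ := hdata _ (hmem c hc)
      have hword := minWord_child (parent c) (minWord_of_mem_tag c)
      have hnest := ne'_child (parent c) (minWord_of_mem_tag c)
      rw [child_parent_tag] at hword hnest
      rw [minWord_child _ (htag c hc), ne'_child _ (htag c hc), h1, h2]
      exact ⟨hword.symm, hnest.symm⟩

theorem ncard_level_le {p q : SetPartition n} (hw : minWord p = minWord q)
    (hne : ne' p = ne' q) (l m c : ℕ) :
    {t ∈ level p l | t.parts.card = m ∧ ne' t = c}.ncard ≤
      {t ∈ level q l | t.parts.card = m ∧ ne' t = c}.ncard := by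
  obtain ⟨f, hmaps, hinj, hdata⟩ := exists_level_map hw hne l
  refine Set.ncard_le_ncard_of_injOn f ?_ (hinj.mono fun t ht => ht.1) (Set.toFinite _)
  rintro t ⟨ht, h1, h2⟩
  obtain ⟨h3, h4⟩ := hdata t ht
  refine ⟨hmaps ht, ?_, h4.trans h2⟩
  rw [card_parts, h3, ← card_parts, h1]

theorem ncard_level_one (p : SetPartition n) (c : ℕ) :
    {t ∈ level p 1 | t.parts.card = p.parts.card ∧ ne' t = ne' p + c}.ncard =
      #{b | minWord p b = true ∧ cost (minWord p) b = c} := by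
  classical
  rw [← Set.ncard_coe_finset {b | minWord p b = true ∧ cost (minWord p) b = c}]
  symm
  have hcard_none : (child p none).parts.card = p.parts.card + 1 := by
    rw [card_parts, card_parts, minWord_child p (by simp), Fin.card_filter_univ_succ]
    simp
  have hcard_some : ∀ b, minWord p b = true →
      (child p (some b)).parts.card = p.parts.card := by
    intro b hb
    rw [card_parts, card_parts, minWord_child p (by simpa using hb), Fin.card_filter_univ_succ]
    have : (univ.filter fun i => minWord p i = true) =
        insert b (univ.filter fun i => Function.update (minWord p) b false i = true) := by
      ext i
      by_cases hi : i = b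
      · simp [hi, hb]
      · simp [hi]
    rw [this, card_insert_of_notMem (by simp)]
    simp only [Fin.cons_zero, if_true, Fin.cons_succ, Option.elim_some]
  have hvalid : ∀ b, minWord p b = true → ∀ b' ∈ some b, minWord p b' = true := by
    rintro b hb b' h
    cases h
    exact hb
  refine Set.ncard_congr (fun b _ => child p (some b)) ?_ ?_ ?_
  · intro b hb
    simp only [coe_filter, mem_univ, true_and, Set.mem_ofPred_eq] at hb
    refine ⟨⟨p, rfl, (isChild_iff _ _).2 (parent_child _ _)⟩, hcard_some b hb.1, ?_⟩
    rw [ne'_child p (hvalid b hb.1), Option.elim_some, hb.2]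
  · intro b b' hb hb' h
    simp only [coe_filter, mem_univ, true_and, Set.mem_ofPred_eq] at hb hb'
    have := congrArg tag h
    rw [tag_child p (hvalid b hb.1), tag_child p (hvalid b' hb'.1)] at this
    exact Option.some_inj.1 this
  · rintro t ⟨⟨r, hr, ht⟩, h1, h2⟩
    obtain rfl : r = p := hr
    rw [isChild_iff] at ht
    subst ht
    rcases htag : tag t with _ | b
    · rw [← htag, child_parent_tag t] at hcard_none
      omega
    · have hb : minWord (parent t) b = true := minWord_of_mem_tag t b htag
      have ht : child (parent t) (some b) = t := by rw [← htag, child_parent_tag]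
      refine ⟨b, ?_, ht⟩
      have hnest := ne'_child (parent t) (hvalid b hb)
      rw [ht, Option.elim_some] at hnest
      simp only [coe_filter, mem_univ, true_and, Set.mem_ofPred_eq]
      exact ⟨hb, by omega⟩

theorem cost_mono (w : Fin n → Bool) : Monotone (cost w) := by
  intro a b hab
  refine card_le_card fun y hy => ?_
  simp only [mem_filter, mem_univ, true_and] at hy ⊢
  exact ⟨hy.1.trans_le hab, hy.2⟩

theorem cost_lt {w : Fin n → Bool} {a b : Fin n} (hab : a < b) (ha : w a = false) :
    cost w a < cost w b := by
  refine card_lt_card ⟨fun y hy => ?_, fun h => ?_⟩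
  · simp only [mem_filter, mem_univ, true_and] at hy ⊢
    exact ⟨hy.1.trans hab, hy.2⟩
  · have := h (x := a) (by simp [hab, ha])
    simp at this

theorem cost_congr {v w : Fin n → Bool} {b : Fin n} (h : ∀ y < b, v y = w y) :
    cost v b = cost w b := by
  unfold cost
  congr 1
  ext y
  simp only [mem_filter, mem_univ, true_and]
  exact and_congr_right fun hy => by rw [h y hy]

/-- Two words with the same distribution of costs of their letters `true` cannot first
differ at a position where the former has `true` and the latter has `false`. -/
theorem eq_true_of_cost_eq {v w : Fin n → Bool} {b : Fin n}
    (h : ∀ c, #{i | v i = true ∧ cost v i = c} = #{i | w i = true ∧ cost w i = c})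
    (hlt : ∀ y < b, v y = w y) (hv : v b = true) : w b = true := by
  by_contra hwb
  rw [Bool.not_eq_true] at hwb
  have hsum : ∀ u : Fin n → Bool, #{i | u i = true ∧ cost u i ≤ cost v b} =
      ∑ c ∈ range (cost v b + 1), #{i | u i = true ∧ cost u i = c} := by
    intro u
    rw [card_eq_sum_card_fiberwise (f := cost u) (t := range (cost v b + 1))]
    · refine sum_congr rfl fun c hc => ?_
      rw [filter_filter]
      congr 1
      ext i
      simp only [mem_range] at hc
      simp only [mem_filter, mem_univ, true_and]
      constructor
      · rintro ⟨⟨h1, -⟩, h2⟩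
        exact ⟨h1, h2⟩
      · rintro ⟨h1, h2⟩
        exact ⟨⟨h1, by omega⟩, h2⟩
    · intro i hi
      simp only [coe_filter, mem_univ, true_and, Set.mem_ofPred_eq] at hi
      simp only [coe_range, Set.mem_Iio]
      omega
  have hcard : #{i | v i = true ∧ cost v i ≤ cost v b} =
      #{i | w i = true ∧ cost w i ≤ cost v b} := by
    rw [hsum, hsum]
    exact sum_congr rfl fun c _ => h c
  refine absurd hcard (ne_of_gt (card_lt_card ⟨fun i hi => ?_, fun hsub => ?_⟩))
  · simp only [mem_filter, mem_univ, true_and] at hi ⊢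
    have hib : i < b := by
      rcases lt_trichotomy i b with hlt' | rfl | hgt
      · exact hlt'
      · simp [hwb] at hi
      · have := cost_lt hgt hwb
        rw [cost_congr hlt] at hi
        omega
    exact ⟨(hlt i hib).trans hi.1, cost_mono v hib.le⟩
  · have := hsub (x := b) (by simp [hv])
    simp [hwb] at this

theorem eq_of_cost_eq {v w : Fin n → Bool}
    (h : ∀ c, #{i | v i = true ∧ cost v i = c} = #{i | w i = true ∧ cost w i = c}) :
    v = w := by
  funext b
  induction b using WellFoundedLT.induction with
  | ind b ih =>
    rw [Bool.eq_iff_iff]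
    exact ⟨eq_true_of_cost_eq h ih,
      eq_true_of_cost_eq (fun c => (h c).symm) fun y hy => (ih y hy).symm⟩

theorem simNe_iff (p q : SetPartition n) :
    SimNe p q ↔ minWord p = minWord q ∧ ne' p = ne' q := by
  constructor
  · intro h
    have h0 := h 0 p.parts.card (ne' p)
    have hp : {t ∈ level p 0 | t.parts.card = p.parts.card ∧ ne' t = ne' p} = {p} := by
      ext t
      constructor
      · exact fun ht => ht.1
      · rintro rfl
        exact ⟨rfl, rfl, rfl⟩
    rw [hp, Set.ncard_singleton] at h0
    obtain ⟨t, ht, h1, h2⟩ := (Set.ncard_pos (Set.toFinite _)).1 (h0 ▸ Nat.one_pos)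
    obtain rfl : t = q := ht
    refine ⟨eq_of_cost_eq fun c => ?_, h2.symm⟩
    rw [← ncard_level_one, ← ncard_level_one, h1, h2]
    exact h 1 _ _
  · rintro ⟨hw, hne⟩ l m c
    exact le_antisymm (ncard_level_le hw hne l m c) (ncard_level_le hw.symm hne.symm l m c)

/-- The number of nestings of a partition is at most `nestBound 0 w`, where `w` is its word of
minima without the first letter: an arc ending at a position `y` with `w y = false` is nested
under at most as many arcs as there are admissible starting points on its left and end points on
its right. The parameter `k` counts additional minima on the left. -/
def nestBound (k : ℕ) (w : Fin n → Bool) : ℕ :=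
  ∑ y, if w y = true then 0 else
    min (k + ∑ x, if x < y ∧ w x = true then 1 else 0) (∑ z, if y < z ∧ w z = false then 1 else 0)

theorem nestBound_zero_cons_false (w : Fin n → Bool) :
    nestBound 0 (Fin.cons false w : Fin (n + 1) → Bool) = nestBound 0 w := by
  simp [nestBound, Fin.sum_univ_succ, -sum_boole]

theorem nestBound_cons_true (k : ℕ) (w : Fin n → Bool) :
    nestBound k (Fin.cons true w : Fin (n + 1) → Bool) = nestBound (k + 1) w := by
  simp [nestBound, Fin.sum_univ_succ, add_assoc, -sum_boole]

theorem nestBound_snoc_true (k : ℕ) (w : Fin n → Bool) :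
    nestBound k (Fin.snoc w true : Fin (n + 1) → Bool) = nestBound k w := by
  simp [nestBound, Fin.sum_univ_castSucc, (Fin.castSucc_lt_last _).not_gt, -sum_boole]

theorem nestBound_snoc_false (k : ℕ) (w : Fin n → Bool) :
    nestBound (k + 1) (Fin.snoc w false : Fin (n + 1) → Bool) =
      nestBound k w + ∑ y, if w y = true then 0 else 1 := by
  rw [nestBound, nestBound, ← sum_add_distrib, Fin.sum_univ_castSucc]
  simp only [Fin.sum_univ_castSucc, Fin.snoc_castSucc, Fin.snoc_last,
    Fin.castSucc_lt_castSucc_iff, Fin.castSucc_lt_last, (Fin.castSucc_lt_last _).not_gt,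
    lt_self_iff_false, false_and, true_and, if_false, if_true, Bool.false_eq_true, and_false,
    sum_const_zero, Nat.min_zero, add_zero]
  refine sum_congr rfl fun y _ => ?_
  split_ifs
  · rfl
  · omega

theorem nestBound_zero_le_one (w : Fin n → Bool) : nestBound 0 w ≤ nestBound 1 w := by
  refine sum_le_sum fun y _ => ?_
  split_ifs
  · exact le_rfl
  · omega

theorem nestBound_one_eq {w : Fin n → Bool} {b : Fin n} (hb : w b = false) :
    nestBound 1 w = nestBound 0 (Function.update w b true) + cost w b +
      min (1 + ∑ x, if x < b ∧ w x = true then 1 else 0)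
        (∑ z, if b < z ∧ w z = false then 1 else 0) := by
  have hleft : ∀ y, (∑ x, if x < y ∧ Function.update w b true x = true then 1 else 0) =
      (∑ x, if x < y ∧ w x = true then 1 else 0) + if b < y then 1 else 0 := by
    intro y
    have := sum_ite_eq' univ b fun x => if x < y then 1 else 0
    rw [if_pos (mem_univ b)] at this
    rw [← this, ← sum_add_distrib]
    refine sum_congr rfl fun x _ => ?_
    by_cases hx : x = b
    · simp [hx, hb]
    · simp [hx]
  have hright : ∀ y, (∑ z, if y < z ∧ w z = false then 1 else 0) =
      (∑ z, if y < z ∧ Function.update w b true z = false then 1 else 0) +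
        if y < b then 1 else 0 := by
    intro y
    have := sum_ite_eq' univ b fun z => if y < z then 1 else 0
    rw [if_pos (mem_univ b)] at this
    rw [← this, ← sum_add_distrib]
    refine sum_congr rfl fun x _ => ?_
    by_cases hx : x = b
    · simp [hx, hb]
    · simp [hx]
  have hsplit := sum_ite_eq' univ b fun y =>
    min (1 + ∑ x, if x < y ∧ w x = true then 1 else 0)
      (∑ z, if y < z ∧ w z = false then 1 else 0)
  rw [if_pos (mem_univ b)] at hsplit
  rw [← hsplit, cost, card_filter, nestBound, nestBound, ← sum_add_distrib, ← sum_add_distrib]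
  refine sum_congr rfl fun y _ => ?_
  rw [hleft y, hright y]
  rcases lt_trichotomy y b with hlt | rfl | hgt
  · simp only [hlt, hlt.ne, hlt.not_gt, ne_eq, not_false_eq_true, Function.update_of_ne, if_true,
      if_false, true_and, add_zero]
    rcases w y
    · simp only [Bool.false_eq_true, if_false, if_true]
      omega
    · simp
  · simp [hb]
  · simp only [hgt, hgt.ne', hgt.not_gt, ne_eq, not_false_eq_true, Function.update_of_ne, if_true,
      if_false, false_and, add_zero]
    rcases w y
    · simp only [Bool.false_eq_true, if_false]
      omega
    · simp

theorem exists_cost_le {w : Fin n → Bool} {e : ℕ} (he : e ≤ nestBound 1 w)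
    (hw : ∃ b, w b = false) :
    ∃ b, w b = false ∧ cost w b ≤ e ∧ e ≤ cost w b + nestBound 0 (Function.update w b true) := by
  classical
  obtain ⟨a, ha⟩ := hw
  obtain ⟨a, ha, hmin⟩ := (univ.filter fun i => w i = false).exists_minimal ⟨a, by simpa using ha⟩
  simp only [mem_filter, mem_univ, true_and] at ha hmin
  have hcost : cost w a = 0 := by
    rw [cost, card_eq_zero, filter_eq_empty_iff]
    rintro y - ⟨hy, hwy⟩
    exact absurd (hmin hwy hy.le) (not_le.2 hy)
  obtain ⟨b, hb, hmax⟩ := (univ.filter fun i => w i = false ∧ cost w i ≤ e).exists_maximal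
    ⟨a, by simp [ha, hcost]⟩
  simp only [mem_filter, mem_univ, true_and] at hb hmax
  refine ⟨b, hb.1, hb.2, ?_⟩
  by_cases hlast : ∃ c, b < c ∧ w c = false
  · obtain ⟨c, hc⟩ := hlast
    obtain ⟨c, hc, hcmin⟩ := (univ.filter fun i => b < i ∧ w i = false).exists_minimal
      ⟨c, by simpa using hc⟩
    simp only [mem_filter, mem_univ, true_and] at hc hcmin
    have hstep : cost w c ≤ cost w b + 1 := by
      rw [cost, cost, ← card_insert_of_notMem (a := b) (by simp)]
      refine card_le_card fun y hy => ?_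
      simp only [mem_insert, mem_filter, mem_univ, true_and] at hy ⊢
      rcases lt_trichotomy y b with hlt | heq | hgt
      · exact Or.inr ⟨hlt, hy.2⟩
      · exact Or.inl heq
      · exact absurd (hcmin ⟨hgt, hy.2⟩ hy.1.le) (not_le.2 hy.1)
    have hce : ¬ cost w c ≤ e := fun h =>
      absurd (hmax ⟨hc.2, h⟩ hc.1.le) (not_le.2 hc.1)
    omega
  · have hzero : (∑ z, if b < z ∧ w z = false then 1 else 0) = 0 :=
      sum_eq_zero fun z _ => if_neg fun h => hlast ⟨z, h⟩
    rw [nestBound_one_eq hb.1, hzero] at he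
    omega

theorem cost_cons_true (w : Fin n → Bool) (b : Fin n) :
    cost (Fin.cons true w : Fin (n + 1) → Bool) b.succ = cost w b := by
  simp [cost, Fin.card_filter_univ_succ]

theorem cost_zero (w : Fin (n + 1) → Bool) : cost w 0 = 0 := by
  simp [cost]

theorem exists_minWord_ne'_iff (m : ℕ) (t : Fin m → Bool) (e : ℕ) :
    (∃ p : SetPartition (m + 1), minWord p = Fin.cons true t ∧ ne' p = e) ↔
      e ≤ nestBound 0 t := by
  induction m generalizing e with
  | zero =>
    have hne : ∀ p : SetPartition 1, ne' p = 0 := by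
      intro p
      rw [ne', Set.ncard_eq_zero]
      ext x
      simp only [Set.mem_ofPred_eq, Set.mem_empty_iff_false, iff_false]
      rintro ⟨h, -⟩
      exact absurd h.1 (by simp [Subsingleton.elim x.1.1 x.1.2])
    simp only [hne, nestBound, univ_eq_empty, sum_empty, Nat.le_zero]
    constructor
    · rintro ⟨p, -, rfl⟩
      rfl
    · rintro rfl
      refine ⟨ofMap id, ?_, rfl⟩
      funext i
      obtain rfl : i = 0 := Fin.ext (by omega)
      rw [minWord_zero, Fin.cons_zero]
  | succ m ih =>
    have hvalid : ∀ (p : SetPartition (m + 1)) (b : Fin (m + 1)), minWord p b = true →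
        ∀ b' ∈ some b, minWord p b' = true := by
      rintro p b hb b' h
      cases h
      exact hb
    constructor
    · rintro ⟨c, hw, rfl⟩
      have hword := minWord_child (parent c) (minWord_of_mem_tag c)
      have hnest := ne'_child (parent c) (minWord_of_mem_tag c)
      have hvalid := minWord_of_mem_tag c
      rw [child_parent_tag] at hword hnest
      rw [hw, Fin.cons_inj] at hword
      have hparent : minWord (parent c) = Fin.cons true (Fin.tail (minWord (parent c))) := by
        rw [← minWord_zero (parent c), Fin.cons_self_tail]
      have hle := (ih _ _).1 ⟨parent c, hparent, rfl⟩
      generalize Fin.tail (minWord (parent c)) = u at hparent hle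
      rw [hparent] at hword hnest hvalid
      rw [hnest, hword.2]
      rcases htag : tag c with _ | b
      · simp only [Option.elim_none, add_zero]
        rw [nestBound_cons_true]
        exact hle.trans (nestBound_zero_le_one u)
      · simp only [Option.elim_some]
        refine Fin.cases ?_ (fun b hb => ?_) b (hvalid b htag)
        · intro
          rwa [Fin.update_cons_zero, nestBound_zero_cons_false, cost_zero, add_zero]
        · rw [Fin.cons_succ] at hb
          rw [← Fin.cons_update, nestBound_cons_true, cost_cons_true,
            nestBound_one_eq (b := b) (by simp), Function.update_idem,
            cost_congr (v := Function.update u b false) (w := u)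
              fun y hy => Function.update_of_ne hy.ne _ _]
          rw [← hb, Function.update_eq_self]
          omega
    · intro he
      obtain ⟨a, u, rfl⟩ : ∃ a u, t = Fin.cons a u := ⟨t 0, Fin.tail t, (Fin.cons_self_tail t).symm⟩
      rcases a with _ | _
      · rw [nestBound_zero_cons_false] at he
        obtain ⟨p, hw, hp⟩ := (ih u e).2 he
        have h0 := hvalid p 0 (minWord_zero p)
        refine ⟨child p (some 0), ?_, ?_⟩
        · rw [minWord_child p h0, Option.elim_some, hw, Fin.update_cons_zero]
        · rw [ne'_child p h0, Option.elim_some, cost_zero, add_zero, hp]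
      · rw [nestBound_cons_true, zero_add] at he
        by_cases hu : ∃ b, u b = false
        · obtain ⟨b, hb, hcost, hle⟩ := exists_cost_le he hu
          obtain ⟨p, hw, hp⟩ := (ih (Function.update u b true) (e - cost u b)).2 (by omega)
          have hpb := hvalid p b.succ (by rw [hw, Fin.cons_succ, Function.update_self])
          refine ⟨child p (some b.succ), ?_, ?_⟩
          · rw [minWord_child p hpb, Option.elim_some, hw, ← Fin.cons_update,
              Function.update_idem, ← hb, Function.update_eq_self]
          · rw [ne'_child p hpb, Option.elim_some, hw, cost_cons_true, hp,
              cost_congr (v := Function.update u b true) (w := u)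
                fun y hy => Function.update_of_ne hy.ne _ _]
            omega
        · push Not at hu
          have hzero : nestBound 1 u = 0 :=
            sum_eq_zero fun y _ => if_pos (by simpa using hu y)
          obtain ⟨p, hw, hp⟩ := (ih u e).2 (by omega)
          refine ⟨child p none, ?_, ?_⟩
          · rw [minWord_child p (by simp), Option.elim_none, hw]
          · rw [ne'_child p (by simp), Option.elim_none, hp, add_zero]

theorem Fcl_succ (m : ℕ) : Fcl (m + 1) = ∑ t : Fin m → Bool, (nestBound 0 t + 1) := by
  have hker : neSetoidAll (m + 1) =
      Setoid.ker fun p : SetPartition (m + 1) => (minWord p, ne' p) := by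
    ext p q
    rw [Setoid.ker_def, Prod.mk.injEq, ← simNe_iff]
    rfl
  have hrange : Set.range (fun p : SetPartition (m + 1) => (minWord p, ne' p)) =
      Set.range fun x : (t : Fin m → Bool) × Fin (nestBound 0 t + 1) =>
        ((Fin.cons true x.1 : Fin (m + 1) → Bool), (x.2 : ℕ)) := by
    ext ⟨w, e⟩
    simp only [Set.mem_range, Prod.mk.injEq]
    constructor
    · rintro ⟨p, rfl, rfl⟩
      have hp : minWord p = Fin.cons true (Fin.tail (minWord p)) := by
        rw [← minWord_zero p, Fin.cons_self_tail]
      have hle := (exists_minWord_ne'_iff m _ _).1 ⟨p, hp, rfl⟩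
      exact ⟨⟨_, ⟨ne' p, Nat.lt_succ_of_le hle⟩⟩, hp.symm, rfl⟩
    · rintro ⟨⟨t, i⟩, rfl, rfl⟩
      exact (exists_minWord_ne'_iff m t i).2 (Nat.le_of_lt_succ i.2)
  have hinj : Function.Injective fun x : (t : Fin m → Bool) × Fin (nestBound 0 t + 1) =>
      ((Fin.cons true x.1 : Fin (m + 1) → Bool), (x.2 : ℕ)) := by
    rintro ⟨t, i⟩ ⟨t', i'⟩ h
    simp only [Prod.mk.injEq, Fin.cons_inj, true_and] at h
    obtain ⟨rfl, h⟩ := h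
    rw [Fin.ext h]
  rw [Fcl, hker, Nat.card_congr (Setoid.quotientKerEquivRange _), hrange,
    Nat.card_congr (Equiv.ofInjective _ hinj).symm, Nat.card_eq_fintype_card, Fintype.card_sigma]
  simp

theorem sum_words_cons (f : (Fin (n + 1) → Bool) → ℕ) :
    ∑ w, f w = ∑ w : Fin n → Bool, f (Fin.cons false w) +
      ∑ w : Fin n → Bool, f (Fin.cons true w) := by
  rw [← (Fin.consEquiv fun _ => Bool).sum_comp, Fintype.sum_prod_type, Fintype.sum_bool, add_comm]
  rfl

theorem sum_words_snoc (f : (Fin (n + 1) → Bool) → ℕ) :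
    ∑ w, f w = ∑ w : Fin n → Bool, f (Fin.snoc w false) +
      ∑ w : Fin n → Bool, f (Fin.snoc w true) := by
  rw [← (Fin.snocEquiv fun _ => Bool).sum_comp, Fintype.sum_prod_type, Fintype.sum_bool, add_comm]
  rfl

theorem two_mul_sum_count_false (n : ℕ) :
    2 * ∑ w : Fin n → Bool, ∑ y, (if w y = true then 0 else 1) = n * 2 ^ n := by
  induction n with
  | zero => simp
  | succ n ih =>
    rw [sum_words_cons]
    simp only [Fin.sum_univ_succ, Fin.cons_zero, Fin.cons_succ, Bool.false_eq_true, if_false,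
      if_true, zero_add, sum_add_distrib (f := fun _ : Fin n → Bool => 1)]
    simp only [sum_const, card_univ, Fintype.card_pi, Fintype.card_bool, prod_const,
      Fintype.card_fin, smul_eq_mul, mul_one]
    rw [pow_succ]
    linarith

theorem sum_nestBound (m : ℕ) :
    16 * (∑ t : Fin (m + 1) → Bool, nestBound 0 t : ℤ) = 2 ^ (m + 1) * (m * (m - 1)) := by
  have hzero : ∀ k, ∑ t : Fin (k + 1) → Bool, nestBound 0 t =
      ∑ t : Fin k → Bool, nestBound 0 t + ∑ t : Fin k → Bool, nestBound 1 t := by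
    intro k
    rw [sum_words_cons]
    simp only [nestBound_zero_cons_false, nestBound_cons_true, zero_add]
  have hone : ∀ k, 2 * ∑ t : Fin (k + 1) → Bool, nestBound 1 t =
      2 * ∑ t : Fin (k + 1) → Bool, nestBound 0 t + k * 2 ^ k := by
    intro k
    rw [hzero, sum_words_snoc, ← two_mul_sum_count_false]
    have hfalse := fun t : Fin k → Bool => nestBound_snoc_false 0 t
    simp only [zero_add] at hfalse
    simp only [nestBound_snoc_true, hfalse, sum_add_distrib]
    ring
  induction m with
  | zero => simp [nestBound]
  | succ m ih =>
    have h := hzero (m + 1)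
    have h' := hone m
    zify at h h'
    rw [pow_succ] at ih ⊢
    push_cast at ih ⊢
    rw [h]
    rw [pow_succ]
    linarith

end SetPartition

/-- Corollary 4.7. `F₁ = 1`, `F₂ = 2`, and for `n ≥ 3`,
`32·F_n = 2^n·(n² - 5n + 22)` (as integers), i.e. `F_n = 2^{n-5}(n² - 5n + 22)`. -/
theorem statement18 :
    Fcl 1 = 1 ∧ Fcl 2 = 2 ∧
    ∀ n : ℕ, 3 ≤ n →
      (32 * Fcl n : ℤ) = 2 ^ n * ((n : ℤ) ^ 2 - 5 * n + 22) := by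
  have hF : ∀ m : ℕ, (32 * Fcl (m + 2) : ℤ) = 2 ^ (m + 2) * ((m : ℤ) ^ 2 - m + 16) := by
    intro m
    have h := SetPartition.sum_nestBound m
    rw [SetPartition.Fcl_succ, sum_add_distrib]
    simp only [sum_const, card_univ, Fintype.card_pi, Fintype.card_bool, prod_const,
      Fintype.card_fin, smul_eq_mul, mul_one]
    push_cast
    rw [pow_succ _ (m + 1)]
    linarith
  refine ⟨?_, ?_, ?_⟩
  · rw [SetPartition.Fcl_succ]
    simp [SetPartition.nestBound]
  · have := hF 0
    norm_num at this
    omega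
  · intro n hn
    obtain ⟨m, rfl⟩ := Nat.exists_eq_add_of_le' (show 2 ≤ n by omega)
    rw [hF]
    push_cast
    ring
end
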